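/- arXiv:2507.11828 — 3 statements merged into one kernel-verified Lean document; each statement's English description precedes it below -/
import Mathlib

section
/- Let q be an odd prime and k ≥ 1 a natural number. Let S and T be finite sets of nonzero integers, neither containing a perfect q-th power. If S belongs to 𝒯_{k,q} and T is geometrically q-equivalent to S, then T belongs to 𝒯_{k,q}. -/
open Finset

/-- `S ∈ 𝒯_{k,q}`: there is a positive integer `Δ` such that for every natural number `N`
with `Ω(N) ≤ k` and `gcd(N, Δ) = 1`, some `s ∈ S` is a `q`-th power modulo `N`. -/
def MemT (q k : ℕ) (S : Set ℤ) : Prop :=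
  ∃ Δ : ℕ, 0 < Δ ∧ ∀ N : ℕ, 0 < N → N.primeFactorsList.length ≤ k → Nat.Coprime N Δ →
    ∃ s ∈ S, ∃ x : ℤ, (N : ℤ) ∣ x ^ q - s

/-- `s` is a perfect `q`-th power of an integer. -/
def IsPerfectPow (q : ℕ) (s : ℤ) : Prop := ∃ r : ℤ, r ^ q = s

/-- The finite set of primes dividing `∏_{s ∈ S} rad_q(|s|)`, i.e. the primes `p` such that
`q ∤ v_p(|s|)` for some `s ∈ S`. -/
def qPrimes (q : ℕ) (S : Finset ℤ) : Finset ℕ :=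
  S.sup fun s => s.natAbs.primeFactors.filter fun p => ¬ q ∣ s.natAbs.factorization p

/-- The vector `(v_{p_1}(|u|) mod q, …, v_{p_n}(|u|) mod q)` where `p_1 < … < p_n`
is the increasing enumeration of the finite set of primes `P`. -/
def vecOf (q : ℕ) (P : Finset ℕ) (u : ℤ) : Fin P.card → ZMod q :=
  fun i => ((u.natAbs.factorization (P.orderIsoOfFin rfl i).1 : ℕ) : ZMod q)

/-- The projective point `⟨v⟩` of `PG(F_q^n)` spanned by a vector `v`. -/
def projPoint {q n : ℕ} (v : Fin n → ZMod q) : Submodule (ZMod q) (Fin n → ZMod q) :=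
  Submodule.span (ZMod q) {v}

/-- The set of projective points associated with `S` in `PG(F_q^n)`,
`n` being the number of distinct primes dividing `∏_{s ∈ S} rad_q(|s|)`. -/
def assocPoints (q : ℕ) (S : Finset ℤ) :
    Set (Submodule (ZMod q) (Fin (qPrimes q S).card → ZMod q)) :=
  {P | ∃ s ∈ S, P = projPoint (vecOf q (qPrimes q S) s)}

/-- `B` is a `k`-blocking set of `PG(F_q^n)`: every subspace of codimension `k`
contains a nonzero vector spanning a point of `B`. -/
def IsBlockingSet (q n k : ℕ) (B : Set (Submodule (ZMod q) (Fin n → ZMod q))) : Prop :=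
  ∀ W : Submodule (ZMod q) (Fin n → ZMod q), Module.finrank (ZMod q) W = n - k →
    ∃ v ∈ W, v ≠ 0 ∧ projPoint v ∈ B

/-- `B` is (the point set of) a `k`-space of `PG(F_q^n)`. -/
def IsKSpace (q n k : ℕ) (B : Set (Submodule (ZMod q) (Fin n → ZMod q))) : Prop :=
  ∃ W : Submodule (ZMod q) (Fin n → ZMod q), Module.finrank (ZMod q) W = k + 1 ∧
    B = {P | ∃ v ∈ W, v ≠ 0 ∧ P = projPoint v}

/-- `S` and `T` are geometrically `q`-equivalent: some element of `PGL(n, q)` maps the point set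
associated with `S` onto the point set associated with `T`, where the points are computed with
respect to all the primes dividing `(∏_{s ∈ S} rad_q(|s|)) ⬝ (∏_{t ∈ T} rad_q(|t|))`. -/
def GeomEquiv (q : ℕ) (S T : Finset ℤ) : Prop :=
  ∃ Ψ : (Fin (qPrimes q (S ∪ T)).card → ZMod q) ≃ₗ[ZMod q]
        (Fin (qPrimes q (S ∪ T)).card → ZMod q),
    (Submodule.map Ψ.toLinearMap) ''
        {P | ∃ s ∈ S, P = projPoint (vecOf q (qPrimes q (S ∪ T)) s)} =
      {P | ∃ t ∈ T, P = projPoint (vecOf q (qPrimes q (S ∪ T)) t)}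

/-- The set of squares of `F_qˣ` together with `0`. -/
def Q0 (q : ℕ) : Set (ZMod q) := {x | (∃ a : ZMod q, a ≠ 0 ∧ a ^ 2 = x) ∨ x = 0}

open Finset

namespace PowRes

open Filter Topology in
lemma euler_bounds {ι : Type*} (x : ι → ℝ) (h0 : ∀ i, 0 ≤ x i) (h1 : ∀ i, x i ≤ 1 / 2)
    (hs : Summable (fun f : ι →₀ ℕ => f.prod fun i k => x i ^ k)) :
    Summable x ∧ (∑' i, x i) ≤ Real.log (∑' f : ι →₀ ℕ, f.prod fun i k => x i ^ k) ∧
      Real.log (∑' f : ι →₀ ℕ, f.prod fun i k => x i ^ k) ≤ (∑' i, x i) + ∑' i, x i ^ 2 := by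
  classical
  set u : (ι →₀ ℕ) → ℝ := fun f => f.prod fun i k => x i ^ k with hu
  set Z := ∑' f, u f with hZ
  have hu0 : ∀ f, 0 ≤ u f := fun f => Finset.prod_nonneg fun i _ => pow_nonneg (h0 i) _
  have hx : Summable x := by
    have := hs.comp_injective (i := fun i : ι => Finsupp.single i 1)
      (fun i j hij => (Finsupp.single_left_inj one_ne_zero).1 hij)
    refine this.congr fun i => ?_
    simp [hu, Finsupp.prod_single_index]
  have hx2 : Summable (fun i => x i ^ 2) := by
    refine Summable.of_nonneg_of_le (fun i => by positivity) (fun i => ?_) hx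
    nlinarith [h0 i, h1 i]
  have key : ∀ (F : Finset ι) (m : ℕ), ∏ i ∈ F, ∑ k ∈ range m, x i ^ k =
      ∑ f ∈ F.finsupp (fun _ => range m), u f := by
    intro F m
    rw [Finset.prod_sum, Finset.finsupp, Finset.sum_map]
    refine Finset.sum_congr rfl fun p _ => ?_
    simp only [hu, Function.Embedding.coeFn_mk]
    rw [Finsupp.prod_of_support_subset _ (Finsupp.support_indicator_subset F p) _ (by simp),
      ← Finset.prod_attach F]
    refine Finset.prod_congr rfl fun i _ => ?_
    rw [Finsupp.indicator_of_mem i.2]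
  have hZ1 : 1 ≤ Z := by
    have := hs.le_tsum 0 (fun f _ => hu0 f)
    simpa [hu] using this
  have hlow : ∀ F : Finset ι, ∏ i ∈ F, (1 - x i)⁻¹ ≤ Z := by
    intro F
    have ht : Tendsto (fun m => ∏ i ∈ F, ∑ k ∈ range m, x i ^ k) atTop
        (𝓝 (∏ i ∈ F, (1 - x i)⁻¹)) := by
      refine tendsto_finsetProd _ fun i _ => ?_
      exact (hasSum_geometric_of_lt_one (h0 i) (by linarith [h1 i])).tendsto_sum_nat
    refine le_of_tendsto' ht fun m => ?_
    rw [key]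
    exact hs.sum_le_tsum _ (fun f _ => hu0 f)
  have hup : ∀ G : Finset (ι →₀ ℕ), ∃ F : Finset ι, ∑ f ∈ G, u f ≤ ∏ i ∈ F, (1 - x i)⁻¹ := by
    intro G
    let F := G.sup fun f => f.support
    let m := (G.sup fun f => f.support.sup fun i => f i) + 1
    refine ⟨F, ?_⟩
    calc ∑ f ∈ G, u f ≤ ∑ f ∈ F.finsupp (fun _ => range m), u f := by
          refine Finset.sum_le_sum_of_subset_of_nonneg ?_ fun f _ _ => hu0 f
          intro f hf
          rw [Finset.mem_finsupp_iff]
          refine ⟨Finset.le_sup (f := fun f : ι →₀ ℕ => f.support) hf, fun i _ => ?_⟩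
          rw [Finset.mem_range]
          by_cases hi : i ∈ f.support
          · have h1 : f i ≤ f.support.sup fun i => f i := Finset.le_sup (f := fun i => f i) hi
            have h2 : (f.support.sup fun i => f i) ≤ G.sup fun f => f.support.sup fun i => f i :=
              Finset.le_sup (f := fun f : ι →₀ ℕ => f.support.sup fun i => f i) hf
            show f i < (G.sup fun f => f.support.sup fun i => f i) + 1
            omega
          · rw [Finsupp.notMem_support_iff.1 hi]; exact Nat.succ_pos _
      _ = ∏ i ∈ F, ∑ k ∈ range m, x i ^ k := (key F m).symm
      _ ≤ _ := by
          refine Finset.prod_le_prod (fun i _ => Finset.sum_nonneg fun k _ => pow_nonneg (h0 i) _) fun i _ => ?_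
          have hh := hasSum_geometric_of_lt_one (h0 i) (by linarith [h1 i])
          rw [← hh.tsum_eq]
          exact hh.summable.sum_le_tsum _ (fun k _ => pow_nonneg (h0 i) _)
  refine ⟨hx, ?_, ?_⟩
  · refine hx.tsum_le_of_sum_le fun F => ?_
    calc ∑ i ∈ F, x i ≤ ∑ i ∈ F, Real.log (1 - x i)⁻¹ := by
          refine Finset.sum_le_sum fun i _ => ?_
          rw [Real.log_inv]
          have := Real.log_le_sub_one_of_pos (x := 1 - x i) (by linarith [h1 i])
          linarith
      _ = Real.log (∏ i ∈ F, (1 - x i)⁻¹) := by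
          rw [Real.log_prod]
          intro i _
          have := h1 i
          exact inv_ne_zero (by linarith)
      _ ≤ _ := Real.log_le_log (Finset.prod_pos fun i _ => inv_pos.2 (by linarith [h1 i])) (hlow F)
  · have hb : ∀ F : Finset ι, ∏ i ∈ F, (1 - x i)⁻¹ ≤ Real.exp ((∑' i, x i) + ∑' i, x i ^ 2) := by
      intro F
      calc ∏ i ∈ F, (1 - x i)⁻¹ ≤ ∏ i ∈ F, Real.exp (x i + x i ^ 2) := by
            refine Finset.prod_le_prod (fun i _ => inv_nonneg.2 (by linarith [h1 i])) fun i _ => ?_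
            have hxi := h1 i
            have hxi0 := h0 i
            have : 1 + (x i + x i ^ 2) + (x i + x i ^ 2) ^ 2 / 2 ≤ Real.exp (x i + x i ^ 2) :=
              Real.quadratic_le_exp_of_nonneg (by positivity)
            refine le_trans ?_ this
            rw [inv_le_iff_one_le_mul₀ (by linarith)]
            nlinarith [pow_nonneg hxi0 2, pow_nonneg hxi0 3, mul_nonneg (pow_nonneg hxi0 2) (sub_nonneg.2 hxi), mul_nonneg (pow_nonneg hxi0 3) (sub_nonneg.2 hxi), mul_nonneg (pow_nonneg hxi0 4) (sub_nonneg.2 hxi)]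
        _ = Real.exp (∑ i ∈ F, (x i + x i ^ 2)) := (Real.exp_sum _ _).symm
        _ ≤ _ := by
            rw [Real.exp_le_exp, Finset.sum_add_distrib]
            exact add_le_add (hx.sum_le_tsum _ fun i _ => h0 i)
              (hx2.sum_le_tsum _ fun i _ => by positivity)
    rw [Real.log_le_iff_le_exp (by linarith)]
    refine hs.tsum_le_of_sum_le fun G => ?_
    obtain ⟨F, hF⟩ := hup G
    exact hF.trans (hb F)

end PowRes

open Finset

set_option linter.unusedSectionVars false

namespace PowRes

open NumberField IsDedekindDomain UniqueFactorizationMonoid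

section
variable (K : Type*) [Field K] [NumberField K]

/-- The ideal with a given factorization. -/
noncomputable def idealOf (f : HeightOneSpectrum (𝓞 K) →₀ ℕ) : Ideal (𝓞 K) :=
  f.prod fun P k => P.asIdeal ^ k

lemma idealOf_eq (f : HeightOneSpectrum (𝓞 K) →₀ ℕ) :
    idealOf K f = ((Finsupp.toMultiset f).map fun P => P.asIdeal).prod := by
  classical
  rw [Finsupp.toMultiset_map, Finsupp.prod_toMultiset, Finsupp.prod_mapDomain_index]
  · rfl
  · simp
  · intros; rw [pow_add]

lemma idealOf_ne_bot (f : HeightOneSpectrum (𝓞 K) →₀ ℕ) : idealOf K f ≠ ⊥ := by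
  rw [idealOf, ← Ideal.zero_eq_bot, Finsupp.prod, Finset.prod_ne_zero_iff]
  intro P _
  exact pow_ne_zero _ P.ne_bot

lemma asIdeal_injective : Function.Injective (fun P : HeightOneSpectrum (𝓞 K) => P.asIdeal) := by
  intro P Q h
  exact HeightOneSpectrum.ext h

lemma idealOf_injective : Function.Injective (idealOf K) := by
  classical
  intro f g h
  rw [idealOf_eq, idealOf_eq] at h
  have h2 := congrArg normalizedFactors h
  rw [normalizedFactors_prod_of_prime, normalizedFactors_prod_of_prime] at h2
  · exact (Function.LeftInverse.injective Finsupp.toMultiset_toFinsupp) (Multiset.map_injective (asIdeal_injective K) h2)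
  · intro p hp
    obtain ⟨P, _, rfl⟩ := Multiset.mem_map.1 hp
    exact P.prime
  · intro p hp
    obtain ⟨P, _, rfl⟩ := Multiset.mem_map.1 hp
    exact P.prime

lemma idealOf_surjective {I : Ideal (𝓞 K)} (hI : I ≠ ⊥) : ∃ f, idealOf K f = I := by
  classical
  obtain ⟨M, hM⟩ : ∃ M : Multiset (HeightOneSpectrum (𝓞 K)),
      M.map (fun P => P.asIdeal) = normalizedFactors I := by
    refine ⟨(normalizedFactors I).pmap (fun p hp => ⟨p, Ideal.isPrime_of_prime hp, hp.ne_zero⟩)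
      (fun p hp => prime_of_normalized_factor p hp), ?_⟩
    rw [Multiset.map_pmap]
    simp [Multiset.pmap_eq_map]
  refine ⟨Multiset.toFinsupp M, ?_⟩
  rw [idealOf_eq, Multiset.toFinsupp_toMultiset, hM]
  exact associated_iff_eq.1 (prod_normalizedFactors hI)

/-- Number of ideals of norm `n`. -/
noncomputable def cnt (n : ℕ) : ℕ := Nat.card {I : Ideal (𝓞 K) // Ideal.absNorm I = n}

lemma summable_cnt {s : ℝ} (hs : 1 < s) : LSeriesSummable (fun n => ((cnt K n : ℝ) : ℂ)) s := by
  refine LSeriesSummable_of_sum_norm_bigO_and_nonneg (f := fun n => (cnt K n : ℝ)) (r := 1) ?_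
    (fun _ => Nat.cast_nonneg _) zero_le_one (by simpa using hs)
  have hlim : Filter.Tendsto (fun n : ℕ => (∑ k ∈ Icc 1 n, (cnt K k : ℝ)) / n) Filter.atTop
      (nhds (dedekindZeta_residue K)) := by
    refine ((Ideal.tendsto_norm_le_div_atTop₀ K).comp tendsto_natCast_atTop_atTop).congr fun n ↦ ?_
    simp only [Function.comp_apply, Nat.cast_le, ← Nat.cast_sum]
    congr
    rw [← add_left_inj 1, ← Ideal.card_norm_le_eq_card_norm_le_add_one,
      show Finset.Icc 1 n = Finset.Ioc 0 n from Finset.Icc_succ_left_eq_Ioc _ _,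
      show 1 = cnt K 0 by simp [cnt, Ideal.absNorm_eq_zero_iff],
      Finset.sum_Ioc_add_eq_sum_Icc (n.zero_le)]
    simp only [cnt]
    rw [← Finset.card_preimage_eq_sum_card_image_eq (fun k _ ↦ Ideal.finite_setOfPred_absNorm_eq k)]
    simp [Set.coe_eq_subtype]
  have := hlim.isBigO_one ℝ
  have h2 := this.mul (Asymptotics.isBigO_refl (fun n : ℕ => (n : ℝ)) Filter.atTop)
  refine (h2.congr' ?_ ?_)
  · filter_upwards [Filter.eventually_ne_atTop 0] with n hn
    field_simp
  · filter_upwards with n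
    simp

lemma norm_idealOf (s : ℝ) (f : HeightOneSpectrum (𝓞 K) →₀ ℕ) :
    (f.prod fun P k => ((Ideal.absNorm P.asIdeal : ℝ) ^ (-s)) ^ k) =
      (Ideal.absNorm (idealOf K f) : ℝ) ^ (-s) := by
  rw [idealOf, Finsupp.prod, Finsupp.prod, map_prod, Nat.cast_prod, ← Real.finsetProd_rpow _ _ (fun i _ => by positivity)]
  refine Finset.prod_congr rfl fun P _ => ?_
  rw [map_pow, Nat.cast_pow, ← Real.rpow_natCast, ← Real.rpow_natCast, ← Real.rpow_mul (by positivity), ← Real.rpow_mul (by positivity), mul_comm]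

lemma zeta_hasSum {s : ℝ} (hs : 1 < s) :
    HasSum (fun f : HeightOneSpectrum (𝓞 K) →₀ ℕ =>
      f.prod fun P k => ((Ideal.absNorm P.asIdeal : ℝ) ^ (-s)) ^ k) (dedekindZeta K s).re := by
  have h1 : HasSum (fun n : ℕ => (cnt K n : ℝ) * (n : ℝ) ^ (-s)) (dedekindZeta K s).re := by
    have := (summable_cnt K hs).hasSum
    have h2 := Complex.hasSum_re this
    have e : (∑' b, LSeries.term (fun n => ((cnt K n : ℝ) : ℂ)) s b) = dedekindZeta K s := by
      simp [dedekindZeta, LSeries, cnt]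
    rw [e] at h2
    convert h2 using 1
    funext n
    rcases Nat.eq_zero_or_pos n with rfl | hn
    · simp [Real.zero_rpow (show -s ≠ 0 by linarith)]
    · rw [LSeries.term_of_ne_zero hn.ne', Real.rpow_neg (by positivity), ← div_eq_mul_inv]
      rw [show ((n : ℂ) ^ (s : ℂ)) = (((n : ℝ) ^ s : ℝ) : ℂ) by
        rw [Complex.ofReal_cpow (by positivity)]; simp, ← Complex.ofReal_div, Complex.ofReal_re]
  have h3 : HasSum (fun I : Ideal (𝓞 K) => (Ideal.absNorm I : ℝ) ^ (-s)) (dedekindZeta K s).re := by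
    rw [← (Equiv.sigmaFiberEquiv (fun I : Ideal (𝓞 K) => Ideal.absNorm I)).hasSum_iff]
    have hfib : ∀ n : ℕ, HasSum (fun c : {I : Ideal (𝓞 K) // Ideal.absNorm I = n} =>
        (Ideal.absNorm c.1 : ℝ) ^ (-s)) ((cnt K n : ℝ) * (n : ℝ) ^ (-s)) := by
      intro n
      have : Finite {I : Ideal (𝓞 K) // Ideal.absNorm I = n} := Ideal.finite_setOfPred_absNorm_eq n
      have := Fintype.ofFinite {I : Ideal (𝓞 K) // Ideal.absNorm I = n}
      have h := hasSum_fintype (fun c : {I : Ideal (𝓞 K) // Ideal.absNorm I = n} =>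
        (Ideal.absNorm c.1 : ℝ) ^ (-s))
      convert h using 1
      rw [Finset.sum_congr rfl (fun c _ => by rw [c.2])]
      simp [cnt, Nat.card_eq_fintype_card]
    refine HasSum.sigma_of_hasSum h1 hfib ?_
    refine (summable_sigma_of_nonneg ?_).2 ⟨fun n => (hfib n).summable, ?_⟩
    · intro x
      simp only [Function.comp]
      positivity
    · refine h1.summable.congr fun n => ?_
      exact (hfib n).tsum_eq.symm
  simp_rw [norm_idealOf]
  have := (idealOf_injective K).hasSum_iff (f := fun I : Ideal (𝓞 K) => (Ideal.absNorm I : ℝ) ^ (-s)) (a := (dedekindZeta K s).re) ?_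
  · exact this.2 h3
  · intro I hI
    have : I = ⊥ := by
      by_contra h
      exact hI (idealOf_surjective K h)
    subst this
    simp [Real.zero_rpow (show -s ≠ 0 by linarith)]
end
end PowRes

open Finset
set_option linter.unusedSectionVars false

namespace PowRes

open NumberField IsDedekindDomain UniqueFactorizationMonoid

section
variable (K : Type*) [Field K] [NumberField K]

lemma two_le_norm (P : HeightOneSpectrum (𝓞 K)) : 2 ≤ Ideal.absNorm P.asIdeal := by
  have h0 : Ideal.absNorm P.asIdeal ≠ 0 := by
    rw [Ne, Ideal.absNorm_eq_zero_iff]; exact P.ne_bot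
  have h1 : Ideal.absNorm P.asIdeal ≠ 1 := by
    rw [Ne, Ideal.absNorm_eq_one_iff]; exact P.isPrime.ne_top
  omega

lemma absNorm_span_nat (p : ℕ) : Ideal.absNorm (Ideal.span {(p : 𝓞 K)}) =
    p ^ Module.finrank ℤ (𝓞 K) := by
  exact Ideal.absNorm_span_natCast p

lemma exists_prime_mem (P : HeightOneSpectrum (𝓞 K)) :
    ∃ p : ℕ, p.Prime ∧ (p : 𝓞 K) ∈ P.asIdeal ∧ ∃ k, 1 ≤ k ∧ Ideal.absNorm P.asIdeal = p ^ k := by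
  have h2 := two_le_norm K P
  have hmem : ((Ideal.absNorm P.asIdeal : ℕ) : 𝓞 K) ∈ P.asIdeal := Ideal.absNorm_mem _
  obtain ⟨p, hp, hpP⟩ : ∃ p : ℕ, p.Prime ∧ (p : 𝓞 K) ∈ P.asIdeal := by
    have : ((((Ideal.absNorm P.asIdeal).primeFactorsList).map (fun n : ℕ => (n : 𝓞 K))).prod) ∈ P.asIdeal := by
      rw [← Nat.cast_list_prod, Nat.prod_primeFactorsList (by omega)]; exact hmem
    obtain ⟨x, hx, hxP⟩ := (Ideal.IsPrime.multiset_prod_mem_iff_exists_mem P.isPrime _).1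
      (show Multiset.prod (Multiset.ofList _) ∈ P.asIdeal by rw [Multiset.prod_coe]; exact this)
    obtain ⟨p, hp, rfl⟩ := List.mem_map.1 (Multiset.mem_coe.1 hx)
    exact ⟨p, Nat.prime_of_mem_primeFactorsList hp, hxP⟩
  refine ⟨p, hp, hpP, ?_⟩
  have hdvd : Ideal.absNorm P.asIdeal ∣ p ^ Module.finrank ℤ (𝓞 K) := by
    rw [← absNorm_span_nat]
    exact Ideal.absNorm_dvd_absNorm_of_le ((Ideal.span_singleton_le_iff_mem _).2 hpP)
  obtain ⟨k, _, hk⟩ := (Nat.dvd_prime_pow hp).1 hdvd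
  refine ⟨k, ?_, hk⟩
  rcases Nat.eq_zero_or_pos k with rfl | h
  · rw [pow_zero] at hk; omega
  · exact h

/-- The rational prime below `P`. -/
noncomputable def below (P : HeightOneSpectrum (𝓞 K)) : ℕ := (exists_prime_mem K P).choose

lemma fiber_card (F : Finset (HeightOneSpectrum (𝓞 K))) (p : ℕ) (hp : 2 ≤ p)
    (hF : ∀ P ∈ F, below K P = p) : F.card ≤ Module.finrank ℤ (𝓞 K) := by
  classical
  have h1 : (∏ P ∈ F, P.asIdeal) ∣ Ideal.span {(p : 𝓞 K)} := by
    refine Finset.prod_dvd_of_coprime ?_ ?_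
    · intro P _ Q _ hPQ
      change IsCoprime P.asIdeal Q.asIdeal
      rw [Ideal.isCoprime_iff_sup_eq]
      refine P.isMaximal.coprime_of_ne Q.isMaximal fun h => hPQ (HeightOneSpectrum.ext h)
    · intro P hP
      rw [Ideal.dvd_span_singleton, ← hF P hP]
      exact (exists_prime_mem K P).choose_spec.2.1
  have h2 := Ideal.absNorm_dvd_absNorm_of_le (Ideal.le_of_dvd h1)
  rw [absNorm_span_nat, map_prod] at h2
  have h3 : p ^ F.card ≤ ∏ P ∈ F, Ideal.absNorm P.asIdeal := by
    refine Finset.pow_card_le_prod _ _ _ fun P hP => ?_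
    obtain ⟨h1, h2, k, hk, hk2⟩ := (exists_prime_mem K P).choose_spec
    change _ = below K P ^ k at hk2
    rw [hk2, hF P hP]
    exact Nat.le_self_pow (by omega) p
  have h4 := h3.trans (Nat.le_of_dvd (by positivity) h2)
  exact (Nat.pow_le_pow_iff_right (by omega)).1 h4

lemma summable_nonprime : Summable (fun P : HeightOneSpectrum (𝓞 K) =>
    if (Ideal.absNorm P.asIdeal).Prime then (0 : ℝ) else (Ideal.absNorm P.asIdeal : ℝ)⁻¹) := by
  classical
  have hs : Summable (fun n : ℕ => ((n : ℝ) ^ 2)⁻¹) := Real.summable_nat_pow_inv.2 one_lt_two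
  refine summable_of_sum_le (c := Module.finrank ℤ (𝓞 K) * ∑' n : ℕ, ((n : ℝ) ^ 2)⁻¹) ?_ ?_
  · intro P; simp only [Pi.zero_apply]; split_ifs <;> positivity
  intro F
  calc _ ≤ ∑ P ∈ F, ((below K P : ℝ) ^ 2)⁻¹ := by
        refine Finset.sum_le_sum fun P _ => ?_
        split_ifs with h
        · positivity
        · obtain ⟨h1, h2, k, hk, hk2⟩ := (exists_prime_mem K P).choose_spec
          change _ = below K P ^ k at hk2
          change (below K P).Prime at h1
          have hk' : 2 ≤ k := by
            by_contra hlt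
            have : k = 1 := by omega
            subst this
            rw [pow_one] at hk2
            exact h (hk2 ▸ h1)
          rw [hk2]
          have : 0 < below K P := h1.pos
          push_cast
          gcongr
          exact_mod_cast this
    _ = ∑ n ∈ F.image (below K), ((F.filter fun P => below K P = n).card : ℝ) * ((n : ℝ) ^ 2)⁻¹ := by
        rw [Finset.sum_comp (fun n : ℕ => ((n : ℝ) ^ 2)⁻¹) (below K)]
        simp
    _ ≤ ∑ n ∈ F.image (below K), (Module.finrank ℤ (𝓞 K) : ℝ) * ((n : ℝ) ^ 2)⁻¹ := by
        refine Finset.sum_le_sum fun n hn => ?_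
        gcongr
        obtain ⟨P, _, rfl⟩ := Finset.mem_image.1 hn
        refine fiber_card K _ (below K P) (exists_prime_mem K P).choose_spec.1.two_le ?_
        intro Q hQ
        exact (Finset.mem_filter.1 hQ).2
    _ = Module.finrank ℤ (𝓞 K) * ∑ n ∈ F.image (below K), ((n : ℝ) ^ 2)⁻¹ := by rw [Finset.mul_sum]
    _ ≤ _ := by
        gcongr
        exact hs.sum_le_tsum _ fun n _ => by positivity

lemma prime_sum {s : ℝ} (hs : Summable (fun P : HeightOneSpectrum (𝓞 K) =>
    (Ideal.absNorm P.asIdeal : ℝ) ^ (-s))) :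
    HasSum (fun l : Nat.Primes => (cnt K l : ℝ) * (l : ℝ) ^ (-s))
     (∑' P : HeightOneSpectrum (𝓞 K), if (Ideal.absNorm P.asIdeal).Prime then
        (Ideal.absNorm P.asIdeal : ℝ) ^ (-s) else 0) := by
  classical
  let e : (Σ l : Nat.Primes, {I : Ideal (𝓞 K) // Ideal.absNorm I = l}) → HeightOneSpectrum (𝓞 K) :=
    fun x => ⟨x.2.1, Ideal.isPrime_of_irreducible_absNorm (by rw [x.2.2]; exact x.1.2), by
      intro h
      have := x.2.2
      rw [h, Ideal.absNorm_bot] at this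
      exact x.1.2.ne_zero this.symm⟩
  have he : Function.Injective e := by
    rintro ⟨l, I, hI⟩ ⟨m, J, hJ⟩ h
    have hIJ : I = J := congrArg HeightOneSpectrum.asIdeal h
    subst hIJ
    have hlm : l = m := Subtype.ext (hI.symm.trans hJ)
    subst hlm
    rfl
  have hs' : Summable (fun P : HeightOneSpectrum (𝓞 K) => if (Ideal.absNorm P.asIdeal).Prime then
        (Ideal.absNorm P.asIdeal : ℝ) ^ (-s) else 0) := by
    refine Summable.of_nonneg_of_le (fun P => ?_) (fun P => ?_) hs
    · split_ifs <;> positivity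
    · split_ifs
      · rfl
      · positivity
  have h1 := (he.hasSum_iff (f := fun P : HeightOneSpectrum (𝓞 K) => if (Ideal.absNorm P.asIdeal).Prime then
        (Ideal.absNorm P.asIdeal : ℝ) ^ (-s) else 0) (a := _) ?_).2 hs'.hasSum
  · refine h1.sigma fun l => ?_
    have : Finite {I : Ideal (𝓞 K) // Ideal.absNorm I = l} := Ideal.finite_setOfPred_absNorm_eq _
    have := Fintype.ofFinite {I : Ideal (𝓞 K) // Ideal.absNorm I = l}
    have h := hasSum_fintype (fun c : {I : Ideal (𝓞 K) // Ideal.absNorm I = l} =>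
        ((l : ℕ) : ℝ) ^ (-s))
    have h2 : ∑ c : {I : Ideal (𝓞 K) // Ideal.absNorm I = l}, ((l : ℕ) : ℝ) ^ (-s) = (cnt K l : ℝ) * (l : ℝ) ^ (-s) := by
      simp [cnt, Nat.card_eq_fintype_card]
    rw [h2] at h
    convert h using 1
    funext c
    simp [e, c.2, l.2]
  · intro P hP
    rw [if_neg]
    intro hpr
    exact hP ⟨⟨⟨_, hpr⟩, P.asIdeal, rfl⟩, rfl⟩

open Filter Topology in
/-- `∑ r(ℓ) ℓ^{-s} = log (1/(s-1)) + O(1)` as `s → 1+`. -/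
theorem star : ∃ C : ℝ, ∀ᶠ s : ℝ in 𝓝[>] 1,
    Summable (fun l : Nat.Primes => (cnt K l : ℝ) * (l : ℝ) ^ (-s)) ∧
    |(∑' l : Nat.Primes, (cnt K l : ℝ) * (l : ℝ) ^ (-s)) + Real.log (s - 1)| ≤ C := by
  have hN : ∀ P : HeightOneSpectrum (𝓞 K), (2 : ℝ) ≤ Ideal.absNorm P.asIdeal :=
    fun P => by exact_mod_cast two_le_norm K P
  have hE : ∀ s : ℝ, 1 < s → _ := fun s hs =>
    euler_bounds (fun P : HeightOneSpectrum (𝓞 K) => (Ideal.absNorm P.asIdeal : ℝ) ^ (-s))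
      (fun P => by positivity)
      (fun P => by
        have h := hN P
        calc (Ideal.absNorm P.asIdeal : ℝ) ^ (-s) ≤ (Ideal.absNorm P.asIdeal : ℝ) ^ (-1 : ℝ) :=
              Real.rpow_le_rpow_of_exponent_le (by linarith) (by linarith)
          _ ≤ 1 / 2 := by
              rw [Real.rpow_neg_one, one_div]
              exact inv_anti₀ (by norm_num) h)
      (zeta_hasSum K hs).summable
  have hE2 : Summable (fun P : HeightOneSpectrum (𝓞 K) => (Ideal.absNorm P.asIdeal : ℝ) ^ (-2 : ℝ)) :=
    (hE 2 one_lt_two).1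
  set C1 := ∑' P : HeightOneSpectrum (𝓞 K), (Ideal.absNorm P.asIdeal : ℝ) ^ (-2 : ℝ)
  have hnp := summable_nonprime K
  set C2 := ∑' P : HeightOneSpectrum (𝓞 K),
    if (Ideal.absNorm P.asIdeal).Prime then (0 : ℝ) else (Ideal.absNorm P.asIdeal : ℝ)⁻¹
  set κ := dedekindZeta_residue K
  have hκ : 0 < κ := dedekindZeta_residue_pos K
  have hlim : Tendsto (fun s : ℝ => (s - 1) * (dedekindZeta K s).re) (𝓝[>] 1) (𝓝 κ) := by
    have := (Complex.continuous_re.tendsto _).comp (tendsto_sub_one_mul_dedekindZeta_nhdsGT K)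
    rw [Complex.ofReal_re] at this
    refine this.congr fun s => ?_
    simp only [Function.comp]
    rw [← Complex.ofReal_one, ← Complex.ofReal_sub, Complex.re_ofReal_mul]
  have hlog := ((Real.continuousAt_log hκ.ne').tendsto.comp hlim)
  have hev : ∀ᶠ s : ℝ in 𝓝[>] 1, |Real.log ((s - 1) * (dedekindZeta K s).re)| ≤ |Real.log κ| + 1 :=
    hlog.abs.eventually_le_const (by linarith)
  refine ⟨|Real.log κ| + 1 + C1 + C2, ?_⟩
  filter_upwards [hev, hlim.eventually_const_lt hκ, self_mem_nhdsWithin] with s h1 h2 hs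
  have hs : 1 < s := hs
  obtain ⟨e1, e2, e3⟩ := hE s hs
  rw [(zeta_hasSum K hs).tsum_eq] at e2 e3
  have hps := prime_sum K e1
  refine ⟨hps.summable, ?_⟩
  rw [hps.tsum_eq]
  have hpos : 0 < (dedekindZeta K s).re := pos_of_mul_pos_right h2 (by linarith)
  rw [Real.log_mul (by linarith) hpos.ne'] at h1
  have hsq : ∑' P : HeightOneSpectrum (𝓞 K), ((Ideal.absNorm P.asIdeal : ℝ) ^ (-s)) ^ 2 ≤ C1 := by
    have hle : ∀ P : HeightOneSpectrum (𝓞 K), ((Ideal.absNorm P.asIdeal : ℝ) ^ (-s)) ^ 2 ≤ (Ideal.absNorm P.asIdeal : ℝ) ^ (-2 : ℝ) := by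
      intro P
      have h := hN P
      rw [← Real.rpow_natCast, ← Real.rpow_mul (by linarith)]
      refine Real.rpow_le_rpow_of_exponent_le (by linarith) ?_
      push_cast; linarith
    exact Summable.tsum_le_tsum hle (Summable.of_nonneg_of_le (fun P => by positivity) hle hE2) hE2
  set X := ∑' P : HeightOneSpectrum (𝓞 K), (Ideal.absNorm P.asIdeal : ℝ) ^ (-s)
  set A := ∑' P : HeightOneSpectrum (𝓞 K), if (Ideal.absNorm P.asIdeal).Prime then
        (Ideal.absNorm P.asIdeal : ℝ) ^ (-s) else 0 with hA
  have hsA : Summable (fun P : HeightOneSpectrum (𝓞 K) => if (Ideal.absNorm P.asIdeal).Prime then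
        (Ideal.absNorm P.asIdeal : ℝ) ^ (-s) else 0) := by
    refine Summable.of_nonneg_of_le (fun P => ?_) (fun P => ?_) e1
    · split_ifs <;> positivity
    · split_ifs
      · rfl
      · positivity
  have hAX : A ≤ X := by
    refine Summable.tsum_le_tsum (fun P => ?_) hsA e1
    split_ifs
    · rfl
    · positivity
  have hXA : X ≤ A + C2 := by
    rw [hA, ← hsA.tsum_add hnp]
    refine Summable.tsum_le_tsum (fun P => ?_) e1 (hsA.add hnp)
    split_ifs
    · simp
    · rw [zero_add, ← Real.rpow_neg_one]
      exact Real.rpow_le_rpow_of_exponent_le (by linarith [hN P]) (by linarith)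
  have hC1 : 0 ≤ C1 := tsum_nonneg fun P => by positivity
  have hC2 : 0 ≤ C2 := by linarith
  rw [abs_le] at h1 ⊢
  constructor <;> linarith [h1.1, h1.2]

end
end PowRes

open Finset
set_option linter.unusedSectionVars false

namespace PowRes

open NumberField Polynomial

section
variable (K : Type*) [Field K] [NumberField K]

lemma cnt_eq_homs (l : ℕ) (hl : l.Prime) : cnt K l = Nat.card (𝓞 K →+* ZMod l) := by
  symm
  have := Fact.mk hl
  have hk : ∀ f : 𝓞 K →+* ZMod l, Ideal.absNorm (RingHom.ker f) = l := by
    intro f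
    rw [Ideal.absNorm_apply, Submodule.cardQuot_apply]
    have := Nat.card_congr
      (RingHom.quotientKerEquivOfSurjective (ZMod.ringHom_surjective f)).toEquiv
    rw [Nat.card_zmod] at this
    exact this
  refine Nat.card_congr (Equiv.ofBijective
    (fun f => (⟨RingHom.ker f, hk f⟩ : {I : Ideal (𝓞 K) // Ideal.absNorm I = l})) ⟨?_, ?_⟩)
  · intro f g h
    have hfg : RingHom.ker f = RingHom.ker g := congrArg Subtype.val h
    ext y : 1
    have h1 : y - ((f y).val : 𝓞 K) ∈ RingHom.ker f := by
      rw [RingHom.mem_ker, map_sub, map_natCast, ZMod.natCast_zmod_val, sub_self]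
    rw [hfg, RingHom.mem_ker, map_sub, map_natCast, ZMod.natCast_zmod_val, sub_eq_zero] at h1
    exact h1.symm
  · rintro ⟨I, hI⟩
    rw [Ideal.absNorm_apply, Submodule.cardQuot_apply] at hI
    have hfin : Finite (𝓞 K ⧸ I) := Nat.finite_of_card_ne_zero (hI ▸ hl.ne_zero)
    have := Fintype.ofFinite (𝓞 K ⧸ I)
    rw [Nat.card_eq_fintype_card] at hI
    let e := ZMod.ringEquivOfPrime (𝓞 K ⧸ I) hl hI
    refine ⟨(e.symm : (𝓞 K ⧸ I) →+* ZMod l).comp (Ideal.Quotient.mk I), Subtype.ext ?_⟩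
    ext y
    simp [RingHom.mem_ker, Ideal.Quotient.eq_zero_iff_mem]

/-- number of `q`-th roots of `a` modulo `l` -/
noncomputable def rt (q a l : ℕ) : ℕ := Nat.card {x : ZMod l // x ^ q = a}

lemma aeval_hom {R A : Type*} [CommRing R] [CommRing A] (g : R →+* A) (θ : R) (P : ℤ[X]) :
    g (aeval θ P) = aeval (g θ) P := by
  have := (aeval_algHom_apply g.toIntAlgHom θ P)
  exact this.symm

lemma cnt_eq_rt_aux (q a : ℕ) (θ : 𝓞 K) (D : ℤ)
    (hθ : θ ^ q = a)
    (hf : ∀ P : ℤ[X], aeval θ P = 0 → (X ^ q - C (a : ℤ)) ∣ P)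
    (hD : ∀ y : 𝓞 K, ∃ P : ℤ[X], (D : 𝓞 K) * y = aeval θ P)
    (l : ℕ) (hl : l.Prime) (hlD : ¬ (l : ℤ) ∣ D) : cnt K l = rt q a l := by
  have := Fact.mk hl
  rw [cnt_eq_homs K l hl, rt]
  have hD0 : (D : ZMod l) ≠ 0 := by
    rwa [Ne, ZMod.intCast_zmod_eq_zero_iff_dvd]
  refine Nat.card_congr (Equiv.ofBijective
    (fun g => (⟨g θ, by rw [← map_pow, hθ, map_natCast]⟩ : {x : ZMod l // x ^ q = a})) ⟨?_, ?_⟩)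
  · intro f g h
    have hfg : f θ = g θ := congrArg Subtype.val h
    ext y : 1
    obtain ⟨P, hP⟩ := hD y
    have h1 := congrArg f hP
    have h2 := congrArg g hP
    rw [aeval_hom, map_mul, map_intCast] at h1 h2
    rw [hfg, ← h2] at h1
    exact mul_left_cancel₀ hD0 h1
  · rintro ⟨x, hx⟩
    choose P hP using hD
    have key : ∀ A B : ℤ[X], aeval θ A = aeval θ B → aeval x A = aeval x B := by
      intro A B h
      obtain ⟨W, hW⟩ := hf (A - B) (by rw [map_sub, h, sub_self])
      have := congrArg (aeval x) hW
      rw [map_sub, map_mul, map_sub, map_pow, aeval_X, aeval_C] at this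
      simp only [algebraMap_int_eq, eq_intCast, Int.cast_natCast, hx, sub_self, zero_mul] at this
      exact sub_eq_zero.1 this
    let g : 𝓞 K →+* ZMod l :=
      { toFun := fun y => (D : ZMod l)⁻¹ * aeval x (P y)
        map_one' := by
          have := key (P 1) (C D) (by rw [← hP, aeval_C]; simp)
          rw [this, aeval_C]
          simp [hD0]
        map_zero' := by
          have := key (P 0) 0 (by rw [← hP]; simp)
          rw [this]; simp
        map_add' := by
          intro y z
          have := key (P (y + z)) (P y + P z) (by rw [map_add, ← hP, ← hP, ← hP, mul_add])
          rw [this, map_add, mul_add]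
        map_mul' := by
          intro y z
          have := key (C D * P (y * z)) (P y * P z) (by
            rw [map_mul, map_mul, ← hP, ← hP, ← hP, aeval_C]; simp; ring)
          rw [map_mul, map_mul, aeval_C] at this
          simp only [algebraMap_int_eq, eq_intCast] at this
          field_simp
          rw [← this] }
    refine ⟨g, Subtype.ext ?_⟩
    change (D : ZMod l)⁻¹ * aeval x (P θ) = x
    have := key (P θ) (C D * X) (by rw [← hP, map_mul, aeval_C, aeval_X]; simp)
    rw [this, map_mul, aeval_C, aeval_X]
    simp only [algebraMap_int_eq, eq_intCast]
    rw [inv_mul_cancel_left₀ hD0]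

end

lemma cnt_rat (l : ℕ) (hl : l.Prime) : cnt ℚ l = 1 := by
  rw [cnt_eq_homs ℚ l hl, Nat.card_eq_one_iff_unique]
  refine ⟨⟨fun f g => ?_⟩, ⟨(Int.castRingHom (ZMod l)).comp Rat.ringOfIntegersEquiv.toRingHom⟩⟩
  have : f.comp Rat.ringOfIntegersEquiv.symm.toRingHom = g.comp Rat.ringOfIntegersEquiv.symm.toRingHom :=
    Subsingleton.elim _ _
  ext y
  have h := RingHom.congr_fun this (Rat.ringOfIntegersEquiv y)
  simp only [RingHom.comp_apply, RingEquiv.toRingHom_eq_coe, RingEquiv.coe_toRingHom,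
    RingEquiv.symm_apply_apply] at h
  exact h

lemma field_aux (q a : ℕ) (hq : q.Prime) (K : Type) [Field K] [NumberField K]
    (i : Algebra ℚ K) (B : PowerBasis ℚ K) (hB : minpoly ℚ B.gen = X ^ q - C (a : ℚ)) :
    ∃ D : ℤ, D ≠ 0 ∧ ∀ l : ℕ, l.Prime → ¬ (l : ℤ) ∣ D → cnt K l = rt q a l := by
  obtain rfl : i = DivisionRing.toRatAlgebra := Subsingleton.elim _ _
  have hroot : B.gen ^ q = (a : K) := by
    have := minpoly.aeval ℚ B.gen
    rw [hB, map_sub, map_pow, aeval_X, aeval_C, sub_eq_zero] at this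
    rw [this]; simp
  have hmonZ : (X ^ q - C (a : ℤ) : ℤ[X]).Monic := monic_X_pow_sub_C _ hq.ne_zero
  have hgen_integral : IsIntegral ℤ B.gen := by
    refine ⟨X ^ q - C (a : ℤ), hmonZ, ?_⟩
    rw [eval₂_sub, eval₂_pow, eval₂_X, eval₂_C, hroot]; simp
  let θ : 𝓞 K := ⟨B.gen, hgen_integral⟩
  have hd := Algebra.discr_not_zero_of_basis ℚ B.basis
  set d := Algebra.discr ℚ B.basis with hddef
  refine ⟨d.num, Rat.num_ne_zero.2 hd, ?_⟩
  have hθv : algebraMap (𝓞 K) K θ = B.gen := rfl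
  have hae : ∀ P : ℤ[X], algebraMap (𝓞 K) K (aeval θ P) = aeval B.gen P :=
    fun P => by rw [aeval_hom, hθv]
  have hinj : Function.Injective (algebraMap (𝓞 K) K) := RingOfIntegers.coe_injective
  refine cnt_eq_rt_aux _ q a θ d.num ?_ ?_ ?_
  · apply hinj
    rw [map_pow, hθv, hroot, map_natCast]
  · intro P hP
    have h1 : aeval B.gen P = 0 := by rw [← hae, hP, map_zero]
    have h2 : aeval B.gen (P.map (Int.castRingHom ℚ)) = 0 := by
      rw [← h1, ← algebraMap_int_eq, aeval_map_algebraMap]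
    have h3 := minpoly.dvd _ _ h2
    have h4 : (X ^ q - C (a : ℚ) : ℚ[X]) = (X ^ q - C (a : ℤ) : ℤ[X]).map (Int.castRingHom ℚ) := by
      simp
    rw [hB, h4] at h3
    exact (map_dvd_map _ Int.cast_injective hmonZ).1 h3
  · intro y
    have hy : IsIntegral ℤ (y : K) := y.2
    have h := Algebra.discr_mul_isIntegral_mem_adjoin ℚ (R := ℤ) (B := B) hgen_integral hy
    rw [← hddef, Algebra.adjoin_singleton_eq_range_aeval] at h
    obtain ⟨P, hP⟩ := h
    refine ⟨C (d.den : ℤ) * P, hinj ?_⟩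
    have hP' : aeval B.gen P = d • (y : K) := hP
    rw [hae, map_mul, map_mul, hP', aeval_C, map_intCast, Algebra.smul_def, ← mul_assoc]
    congr 1
    have : (d.num : ℚ) = d.den * d := by rw [mul_comm]; exact (Rat.mul_den_eq_num d).symm
    have h2 := congrArg (algebraMap ℚ K) this
    rw [map_mul, map_intCast, map_natCast] at h2
    rw [h2]
    congr 1
    simp

lemma exists_field (q a : ℕ) (hq : q.Prime) (ha : ∀ r : ℚ, r ^ q ≠ a) :
    ∃ (K : Type) (_ : Field K) (_ : NumberField K) (D : ℤ), D ≠ 0 ∧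
      ∀ l : ℕ, l.Prime → ¬ (l : ℤ) ∣ D → cnt K l = rt q a l := by
  have hirr := X_pow_sub_C_irreducible_of_prime hq ha
  have hmonic : (X ^ q - C (a : ℚ)).Monic := monic_X_pow_sub_C _ hq.ne_zero
  generalize hfdef : (X ^ q - C (a : ℚ)) = f at hirr hmonic
  have := Fact.mk hirr
  have hf0 : f ≠ 0 := hirr.ne_zero
  have hfin := (AdjoinRoot.powerBasis hf0).finite
  have hnf : NumberField (AdjoinRoot f) :=
    { to_charZero := inferInstance
      to_finiteDimensional := by convert hfin }
  refine ⟨AdjoinRoot f, inferInstance, hnf,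
    field_aux q a hq _ _ (AdjoinRoot.powerBasis hf0) ?_⟩
  rw [AdjoinRoot.powerBasis_gen, AdjoinRoot.minpoly_root hf0, hmonic.leadingCoeff, hfdef]
  simp

end PowRes

open Finset
set_option linter.unusedSectionVars false

namespace PowRes
open Filter Topology

/-- The Dirichlet series of `f` over the primes is bounded near `1+`. -/
def Good (f : Nat.Primes → ℝ) : Prop := ∃ C : ℝ, ∀ᶠ s : ℝ in 𝓝[>] 1,
    Summable (fun l : Nat.Primes => f l * (l : ℝ) ^ (-s)) ∧
    |∑' l : Nat.Primes, f l * (l : ℝ) ^ (-s)| ≤ C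

lemma Good.const_mul {f : Nat.Primes → ℝ} (hf : Good f) (c : ℝ) : Good (fun l => c * f l) := by
  obtain ⟨C, hC⟩ := hf
  refine ⟨|c| * C, ?_⟩
  filter_upwards [hC] with s ⟨h1, h2⟩
  simp only [mul_assoc]
  refine ⟨h1.mul_left c, ?_⟩
  rw [tsum_mul_left, abs_mul]
  gcongr

lemma Good.add {f g : Nat.Primes → ℝ} (hf : Good f) (hg : Good g) : Good (fun l => f l + g l) := by
  obtain ⟨C, hC⟩ := hf
  obtain ⟨D, hD⟩ := hg
  refine ⟨C + D, ?_⟩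
  filter_upwards [hC, hD] with s ⟨h1, h2⟩ ⟨h3, h4⟩
  simp only [add_mul]
  refine ⟨h1.add h3, ?_⟩
  rw [h1.tsum_add h3]
  exact (abs_add_le _ _).trans (by gcongr)

lemma good_zero : Good (fun _ => 0) := by
  refine ⟨0, ?_⟩
  filter_upwards with s
  simp

lemma Good.sum {ι : Type*} (F : Finset ι) (f : ι → Nat.Primes → ℝ) (h : ∀ i ∈ F, Good (f i)) :
    Good (fun l => ∑ i ∈ F, f i l) := by
  classical
  induction F using Finset.induction_on with
  | empty => simpa using good_zero
  | insert i F hi ih =>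
    simp only [Finset.sum_insert hi]
    exact (h i (by simp)).add (ih fun j hj => h j (by simp [hj]))

lemma good_of_finite {f : Nat.Primes → ℝ} (F : Finset Nat.Primes) (hf : ∀ l ∉ F, f l = 0) :
    Good f := by
  refine ⟨∑ l ∈ F, |f l|, ?_⟩
  filter_upwards [self_mem_nhdsWithin] with s hs
  have hs : 1 < s := hs
  have h0 : ∀ l ∉ F, f l * (l : ℝ) ^ (-s) = 0 := fun l hl => by rw [hf l hl, zero_mul]
  refine ⟨summable_of_ne_finset_zero h0, ?_⟩
  rw [tsum_eq_sum h0]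
  refine (Finset.abs_sum_le_sum_abs _ _).trans (Finset.sum_le_sum fun l _ => ?_)
  rw [abs_mul, abs_of_nonneg (Real.rpow_nonneg (by positivity) _)]
  refine mul_le_of_le_one_right (abs_nonneg _) ?_
  exact Real.rpow_le_one_of_one_le_of_nonpos (by exact_mod_cast l.2.one_lt.le) (by linarith)

lemma Good.congr {f g : Nat.Primes → ℝ} (hf : Good f) (M : ℕ)
    (h : ∀ l : Nat.Primes, M < (l : ℕ) → f l = g l) : Good g := by
  have hfin : {l : Nat.Primes | (l : ℕ) ≤ M}.Finite :=
    Set.Finite.preimage Subtype.val_injective.injOn (Set.finite_Iic M)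
  have h2 : Good (fun l => g l - f l) := good_of_finite hfin.toFinset (by
    intro l hl
    rw [Set.Finite.mem_toFinset] at hl
    rw [h l (not_le.1 hl), sub_self])
  have := hf.add h2
  simpa using this

lemma good_rt (q a : ℕ) (hq : q.Prime) (ha : ∀ r : ℚ, r ^ q ≠ a) :
    Good (fun l => (rt q a l : ℝ) - 1) := by
  obtain ⟨K, _, _, D, hD, hcnt⟩ := exists_field q a hq ha
  have h1 : Good (fun l => (cnt K l : ℝ) - 1) := by
    obtain ⟨C, hC⟩ := star K
    obtain ⟨C', hC'⟩ := star ℚ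
    refine ⟨C + C', ?_⟩
    filter_upwards [hC, hC'] with s ⟨h1, h2⟩ ⟨h3, h4⟩
    have e : ∀ l : Nat.Primes, (cnt ℚ l : ℝ) = 1 := fun l => by rw [cnt_rat l l.2]; simp
    simp only [e, one_mul] at h3 h4
    simp only [sub_mul, one_mul]
    refine ⟨h1.sub h3, ?_⟩
    rw [h1.tsum_sub h3]
    rw [abs_le] at *
    constructor <;> linarith [h2.1, h2.2, h4.1, h4.2]
  refine h1.congr D.natAbs fun l hl => ?_
  rw [hcnt l l.2]
  intro hdvd
  have := Nat.le_of_dvd (Int.natAbs_pos.2 hD) (Int.natCast_dvd.1 hdvd)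
  omega

open ArithmeticFunction.vonMangoldt in
lemma not_good (q : ℕ) [NeZero q] :
    ¬ Good (fun l => if ((l : ℕ) : ZMod q) = 1 then 1 else 0) := by
  rintro ⟨C, hC⟩
  -- summability of `∑ 1/l`
  have hsum : Summable (fun l : Nat.Primes => (if ((l : ℕ) : ZMod q) = 1 then (1 : ℝ) else 0) * (l : ℝ)⁻¹) := by
    refine summable_of_sum_le (c := C) (fun l => by positivity) fun F => ?_
    have hlim : Tendsto (fun s : ℝ => ∑ l ∈ F, (if ((l : ℕ) : ZMod q) = 1 then (1 : ℝ) else 0) * (l : ℝ) ^ (-s))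
        (𝓝[>] 1) (𝓝 (∑ l ∈ F, (if ((l : ℕ) : ZMod q) = 1 then (1 : ℝ) else 0) * (l : ℝ)⁻¹)) := by
      refine tendsto_nhdsWithin_of_tendsto_nhds ?_
      refine tendsto_finsetSum _ fun l _ => ?_
      refine Tendsto.const_mul _ ?_
      have hl : (l : ℝ) ≠ 0 := by exact_mod_cast l.2.ne_zero
      have hc : Continuous (fun s : ℝ => (l : ℝ) ^ (-s)) := by
        refine Continuous.rpow continuous_const continuous_neg fun s => Or.inl hl
      have := hc.tendsto 1
      rwa [Real.rpow_neg_one] at this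
    refine le_of_tendsto hlim ?_
    filter_upwards [hC] with s ⟨h1, h2⟩
    refine (h1.sum_le_tsum F fun l _ => by positivity).trans ((le_abs_self _).trans h2)
  -- transfer to `ℕ`
  let g : ℕ → ℝ := fun n => if n.Prime ∧ (n : ZMod q) = 1 then (n : ℝ)⁻¹ else 0
  have hg : Summable g := by
    have hinj : Function.Injective (fun l : Nat.Primes => (l : ℕ)) := Subtype.val_injective
    rw [← hinj.summable_iff]
    · convert hsum using 2 with l
      simp [g, l.2]
    · intro n hn
      simp only [g]
      rw [if_neg]
      rintro ⟨h1, _⟩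
      exact hn ⟨⟨n, h1⟩, rfl⟩
  have hg0 : ∀ n, 0 ≤ g n := fun n => by simp only [g]; split_ifs <;> positivity
  have hnp := summable_residueClass_non_primes_div (1 : ZMod q)
  set A := ∑' n : ℕ, (if n.Prime then 0 else residueClass (1 : ZMod q) n) / n
  obtain ⟨C', hC'⟩ := LSeries_residueClass_lower_bound (q := q) (a := 1) isUnit_one
  let u : ℝ → ℕ → ℝ := fun x n => g n * ((x - 1) * Real.log n * (n : ℝ) ^ (-(x - 1)))
  have hub : ∀ x : ℝ, 1 < x → ∀ n, 0 ≤ u x n ∧ u x n ≤ g n := by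
    intro x hx n
    rcases Nat.eq_zero_or_pos n with rfl | hn
    · simp [u, g]
    have hn' : (1 : ℝ) ≤ n := by exact_mod_cast hn
    have hlog := Real.log_nonneg hn'
    have hx1 : 0 ≤ x - 1 := by linarith
    refine ⟨mul_nonneg (hg0 n) (by positivity), mul_le_of_le_one_right (hg0 n) ?_⟩
    rw [Real.rpow_def_of_pos (by linarith)]
    have h1 : Real.log n * (-(x - 1)) = -((x - 1) * Real.log n) := by ring
    rw [h1, Real.exp_neg]
    have h2 := Real.add_one_le_exp ((x - 1) * Real.log n)
    have h3 := Real.exp_pos ((x - 1) * Real.log n)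
    rw [← div_eq_mul_inv, div_le_one h3]
    linarith
  have hlim : Tendsto (fun x : ℝ => ∑' n, u x n) (𝓝[>] 1) (𝓝 (∑' _ : ℕ, (0 : ℝ))) := by
    refine tendsto_tsum_of_dominated_convergence hg (fun n => ?_) ?_
    · refine tendsto_nhdsWithin_of_tendsto_nhds ?_
      rcases Nat.eq_zero_or_pos n with rfl | hn
      · simp [u, g]
      have hc : Continuous (fun x : ℝ => u x n) := by
        have : (n : ℝ) ≠ 0 := by exact_mod_cast hn.ne'
        have h2 : Continuous (fun x : ℝ => (n : ℝ) ^ (-(x - 1))) :=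
          Continuous.rpow continuous_const (by fun_prop) fun s => Or.inl this
        simp only [u]
        fun_prop
      have := hc.tendsto 1
      simpa [u] using this
    · filter_upwards [self_mem_nhdsWithin] with x hx n
      rw [Real.norm_eq_abs, abs_of_nonneg (hub x hx n).1]
      exact (hub x hx n).2
  rw [tsum_zero] at hlim
  have hlim2 : Tendsto (fun x : ℝ => (∑' n, u x n) + (x - 1) * (A + C')) (𝓝[>] 1) (𝓝 0) := by
    have : Tendsto (fun x : ℝ => (x - 1) * (A + C')) (𝓝[>] 1) (𝓝 0) := by
      refine tendsto_nhdsWithin_of_tendsto_nhds ?_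
      have hc : Continuous (fun x : ℝ => (x - 1) * (A + C')) := by fun_prop
      simpa using hc.tendsto 1
    simpa using hlim.add this
  have hφ : 0 < (q.totient : ℝ)⁻¹ := inv_pos.mpr (by exact_mod_cast Nat.totient_pos.2 (NeZero.pos q))
  have hIoc : Set.Ioc (1 : ℝ) 2 ∈ 𝓝[>] (1 : ℝ) := Ioc_mem_nhdsGT one_lt_two
  refine absurd (ge_of_tendsto hlim2 (b := (q.totient : ℝ)⁻¹) ?_) (not_le.2 hφ)
  filter_upwards [hIoc] with x hx
  have hx1 : 0 < x - 1 := by linarith [hx.1]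
  have hus : Summable (u x) := Summable.of_nonneg_of_le (fun n => (hub x hx.1 n).1)
    (fun n => (hub x hx.1 n).2) hg
  have hle : (x - 1) * ∑' n, residueClass (1 : ZMod q) n / (n : ℝ) ^ x ≤
      (∑' n, u x n) + (x - 1) * A := by
    rw [← tsum_mul_left, ← tsum_mul_left, ← hus.tsum_add (hnp.mul_left _)]
    have hpt : ∀ n : ℕ, (x - 1) * (residueClass (1 : ZMod q) n / (n : ℝ) ^ x) ≤
       u x n + (x - 1) * ((if n.Prime then 0 else residueClass (1 : ZMod q) n) / n) := by
      intro n
      rcases Nat.eq_zero_or_pos n with rfl | hn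
      · simp [u, g]
      have hn' : (1 : ℝ) ≤ n := by exact_mod_cast hn
      have hn0 : (0 : ℝ) < n := by linarith
      by_cases hp : n.Prime
      · rw [if_pos hp, zero_div, mul_zero, add_zero]
        by_cases h1 : (n : ZMod q) = 1
        · have : residueClass (1 : ZMod q) n = Real.log n := by
            rw [residueClass, Set.indicator_of_mem (by exact h1),
              ArithmeticFunction.vonMangoldt_apply_prime hp]
          rw [this]
          simp only [u, g]
          rw [if_pos ⟨hp, h1⟩]
          apply le_of_eq
          have : (n : ℝ) ^ x = n * n ^ (x - 1) := by
            rw [← Real.rpow_one_add' hn0.le (by linarith)]; congr 1; ring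
          rw [this, Real.rpow_neg hn0.le]
          field_simp
        · have : residueClass (1 : ZMod q) n = 0 := by
            rw [residueClass, Set.indicator_of_notMem (by exact h1)]
          rw [this, zero_div, mul_zero]
          exact (hub x hx.1 n).1
      · rw [if_neg hp]
        have h1 := (hub x hx.1 n).1
        have h2 : residueClass (1 : ZMod q) n / (n : ℝ) ^ x ≤ residueClass (1 : ZMod q) n / n := by
          refine div_le_div_of_nonneg_left (residueClass_nonneg _ _) hn0 ?_
          conv_lhs => rw [← Real.rpow_one n]
          exact Real.rpow_le_rpow_of_exponent_le hn' hx.1.le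
        have := mul_le_mul_of_nonneg_left h2 hx1.le
        linarith
    have hr := hus.add (hnp.mul_left (x - 1))
    refine Summable.tsum_le_tsum hpt ?_ hr
    refine Summable.of_nonneg_of_le (fun n => ?_) hpt hr
    have := residueClass_nonneg (1 : ZMod q) n
    positivity
  have h3 := mul_le_mul_of_nonneg_left (hC' hx) hx1.le
  have h4 : (x - 1) * ((q.totient : ℝ)⁻¹ / (x - 1) - C') = (q.totient : ℝ)⁻¹ - (x - 1) * C' := by
    field_simp
  rw [h4] at h3
  linarith

end PowRes

open Finset
set_option linter.unusedSectionVars false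

namespace PowRes

lemma modeq_iff (q l : ℕ) (hl : l.Prime) : ((l : ℕ) : ZMod q) = 1 ↔ q ∣ l - 1 := by
  rw [← ZMod.natCast_eq_zero_iff, Nat.cast_sub hl.one_lt.le, Nat.cast_one, sub_eq_zero]

lemma card_units (l : ℕ) (hl : l.Prime) : Nat.card (ZMod l)ˣ = l - 1 := by
  have := Fact.mk hl
  rw [Nat.card_eq_fintype_card, ZMod.card_units]

lemma exists_log (q l : ℕ) (hq : q.Prime) (hl : l.Prime) : ∃ ψ : ZMod l → ZMod q,
    (∀ x y, x ≠ 0 → y ≠ 0 → ψ (x * y) = ψ x + ψ y) ∧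
    (∀ x, x ≠ 0 → (ψ x = 0 ↔ ∃ w, w ^ q = x)) := by
  classical
  have := Fact.mk hl
  have := Fact.mk hq
  suffices h : ∃ φ : (ZMod l)ˣ →* Multiplicative (ZMod q), ∀ u, φ u = 1 ↔ ∃ w, w ^ q = u by
    obtain ⟨φ, hφ⟩ := h
    refine ⟨fun x => if h : x = 0 then 0 else (φ (Units.mk0 x h)).toAdd, ?_, ?_⟩
    · intro x y hx hy
      simp only [hx, hy, mul_eq_zero, or_self, dite_false]
      rw [Units.mk0_mul, map_mul, toAdd_mul]
    · intro x hx
      simp only [hx, dite_false]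
      rw [toAdd_eq_zero, hφ]
      constructor
      · rintro ⟨w, hw⟩
        exact ⟨w, by rw [← Units.val_pow_eq_pow_val, hw, Units.val_mk0]⟩
      · rintro ⟨w, hw⟩
        have hw0 : w ≠ 0 := by
          rintro rfl
          rw [zero_pow hq.ne_zero] at hw
          exact hx hw.symm
        exact ⟨Units.mk0 w hw0, Units.ext (by simpa using hw)⟩
  by_cases hdvd : q ∣ Nat.card (ZMod l)ˣ
  · let e := zmodCyclicMulEquiv (G := (ZMod l)ˣ) inferInstance
    have : NeZero (Nat.card (ZMod l)ˣ) := ⟨Nat.card_pos.ne'⟩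
    refine ⟨(AddMonoidHom.toMultiplicative (ZMod.castHom hdvd (ZMod q)).toAddMonoidHom).comp
      e.symm.toMonoidHom, fun u => ?_⟩
    have h1 : ((AddMonoidHom.toMultiplicative (ZMod.castHom hdvd (ZMod q)).toAddMonoidHom).comp
      e.symm.toMonoidHom) u = Multiplicative.ofAdd (ZMod.castHom hdvd (ZMod q) (e.symm u).toAdd) := rfl
    rw [h1, ofAdd_eq_one]
    constructor
    · intro h
      rw [ZMod.castHom_apply, ZMod.cast_eq_val, ZMod.natCast_eq_zero_iff] at h
      obtain ⟨m, hm⟩ := h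
      refine ⟨e (Multiplicative.ofAdd (m : ZMod _)), ?_⟩
      rw [← map_pow, ← ofAdd_nsmul, nsmul_eq_mul, ← Nat.cast_mul, ← hm, ZMod.natCast_zmod_val]
      simp
    · rintro ⟨w, rfl⟩
      rw [map_pow, toAdd_pow, nsmul_eq_mul, map_mul, map_natCast]
      simp
  · have hco : (Nat.card (ZMod l)ˣ).Coprime q :=
      ((Nat.Prime.coprime_iff_not_dvd hq).2 hdvd).symm
    refine ⟨1, fun u => ?_⟩
    simp only [MonoidHom.one_apply, true_iff]
    exact (powCoprime hco).surjective u

lemma rt_one (q a l : ℕ) (hq : q.Prime) (hl : l.Prime) (h1 : ((l : ℕ) : ZMod q) ≠ 1)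
    (ha : (a : ZMod l) ≠ 0) : rt q a l = 1 := by
  have := Fact.mk hl
  rw [Ne, modeq_iff q l hl, ← card_units l hl] at h1
  have hco : (Nat.card (ZMod l)ˣ).Coprime q := ((Nat.Prime.coprime_iff_not_dvd hq).2 h1).symm
  have hne : ∀ x : ZMod l, x ^ q = a → x ≠ 0 := by
    rintro x hx rfl
    rw [zero_pow hq.ne_zero] at hx
    exact ha hx.symm
  rw [rt, Nat.card_eq_one_iff_unique]
  refine ⟨⟨?_⟩, ?_⟩
  · rintro ⟨x, hx⟩ ⟨y, hy⟩
    have h : powCoprime hco (Units.mk0 x (hne x hx)) = powCoprime hco (Units.mk0 y (hne y hy)) := by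
      apply Units.ext
      simp [hx, hy]
    have := congrArg Units.val ((powCoprime hco).injective h)
    exact Subtype.ext (by simpa using this)
  · obtain ⟨w, hw⟩ := (powCoprime hco).surjective (Units.mk0 (a : ZMod l) ha)
    refine ⟨⟨w, ?_⟩⟩
    have := congrArg Units.val hw
    simpa using this

open Classical in
lemma rt_ite (q a l : ℕ) (hq : q.Prime) (hl : l.Prime) (h1 : ((l : ℕ) : ZMod q) = 1)
    (ha : (a : ZMod l) ≠ 0) : rt q a l = if ∃ w : ZMod l, w ^ q = a then q else 0 := by
  have := Fact.mk hl
  have := Fact.mk hq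
  rw [modeq_iff q l hl, ← card_units l hl, Nat.card_eq_fintype_card] at h1
  obtain ⟨ζ, hζ⟩ := exists_prime_orderOf_dvd_card q h1
  have hp : IsPrimitiveRoot (ζ : ZMod l) q := by
    rw [IsPrimitiveRoot.coe_units_iff, ← hζ]; exact IsPrimitiveRoot.orderOf ζ
  rw [← hp.card_nthRoots, rt]
  have hnd := hp.nthRoots_nodup ha
  rw [← Multiset.toFinset_card_of_nodup hnd]
  rw [Nat.card_eq_fintype_card]
  refine Fintype.card_of_subtype _ fun x => ?_
  rw [Multiset.mem_toFinset, Polynomial.mem_nthRoots hq.pos]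

lemma count {V : Type*} [AddCommGroup V] [Fintype V] (q : ℕ) [Fact q.Prime] [Module (ZMod q) V]
    (f g : V →ₗ[ZMod q] ZMod q) (v : V) (hf : f v = 0) (hg : g v ≠ 0) :
    (univ.filter fun w => f w = 0).card = q * (univ.filter fun w => f w = 0 ∧ g w = 0).card := by
  classical
  have hmaps : ∀ w ∈ univ.filter (fun w => f w = 0), g w ∈ (univ : Finset (ZMod q)) := by simp
  rw [Finset.card_eq_sum_card_fiberwise hmaps]
  have : ∀ c ∈ (univ : Finset (ZMod q)), ((univ.filter fun w => f w = 0).filter fun w => g w = c).card =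
      (univ.filter fun w => f w = 0 ∧ g w = 0).card := by
    intro c _
    refine Finset.card_bij' (fun w _ => w - (c * (g v)⁻¹) • v) (fun w _ => w + (c * (g v)⁻¹) • v)
      ?_ ?_ ?_ ?_
    · intro w hw
      simp only [mem_filter, mem_univ, true_and] at hw ⊢
      simp [hw.1, hw.2, hf, hg]
    · intro w hw
      simp only [mem_filter, mem_univ, true_and] at hw ⊢
      simp [hw.1, hw.2, hf, hg]
    · intro w _; simp
    · intro w _; simp
  rw [Finset.sum_congr rfl this]
  simp [ZMod.card]

/-- A choice of discrete logarithm mod `q`. -/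
noncomputable def lg (q l : ℕ) : ZMod l → ZMod q :=
  open Classical in if h : q.Prime ∧ l.Prime then (exists_log q l h.1 h.2).choose else 0

lemma lg_mul {q l : ℕ} (hq : q.Prime) (hl : l.Prime) {x y : ZMod l} (hx : x ≠ 0) (hy : y ≠ 0) :
    lg q l (x * y) = lg q l x + lg q l y := by
  rw [lg, dif_pos ⟨hq, hl⟩]
  exact (exists_log q l hq hl).choose_spec.1 x y hx hy

lemma lg_eq_zero {q l : ℕ} (hq : q.Prime) (hl : l.Prime) {x : ZMod l} (hx : x ≠ 0) :
    lg q l x = 0 ↔ ∃ w, w ^ q = x := by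
  rw [lg, dif_pos ⟨hq, hl⟩]
  exact (exists_log q l hq hl).choose_spec.2 x hx

lemma lg_one {q l : ℕ} (hq : q.Prime) (hl : l.Prime) : lg q l 1 = 0 := by
  have := Fact.mk hl
  have h := lg_mul hq hl (one_ne_zero (α := ZMod l)) one_ne_zero
  rw [mul_one] at h
  simpa using h

lemma lg_pow {q l : ℕ} (hq : q.Prime) (hl : l.Prime) {x : ZMod l} (hx : x ≠ 0) (n : ℕ) :
    lg q l (x ^ n) = n * lg q l x := by
  have := Fact.mk hl
  induction n with
  | zero => simp [lg_one hq hl]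
  | succ n ih =>
    rw [pow_succ, lg_mul hq hl (pow_ne_zero n hx) hx, ih]; push_cast; ring

lemma lg_prod {q l : ℕ} (hq : q.Prime) (hl : l.Prime) {ι : Type*} (F : Finset ι) (f : ι → ZMod l)
    (hf : ∀ i ∈ F, f i ≠ 0) : lg q l (∏ i ∈ F, f i) = ∑ i ∈ F, lg q l (f i) := by
  classical
  have := Fact.mk hl
  induction F using Finset.induction_on with
  | empty => simp [lg_one hq hl]
  | insert i F hi ih =>
    have h2 : ∀ j ∈ F, f j ≠ 0 := fun j hj => hf j (by simp [hj])
    rw [Finset.prod_insert hi, Finset.sum_insert hi,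
      lg_mul hq hl (hf i (by simp)) (Finset.prod_ne_zero_iff.2 h2), ih h2]

/-- The `i`-th prime of `P`. -/
noncomputable def pr (P : Finset ℕ) (i : Fin P.card) : ℕ := (P.orderIsoOfFin rfl i).1

lemma pr_mem (P : Finset ℕ) (i : Fin P.card) : pr P i ∈ P := (P.orderIsoOfFin rfl i).2

lemma pr_inj (P : Finset ℕ) : Function.Injective (pr P) := fun i j h =>
  (P.orderIsoOfFin rfl).injective (Subtype.ext h)

lemma sum_pr {M : Type*} [AddCommMonoid M] (P : Finset ℕ) (f : ℕ → M) :
    ∑ i, f (pr P i) = ∑ p ∈ P, f p := by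
  rw [← Finset.sum_coe_sort P f]
  exact Fintype.sum_equiv (P.orderIsoOfFin rfl).toEquiv _ _ fun i => rfl

/-- The linear functional attached to the prime `l`. -/
noncomputable def chi (q : ℕ) (P : Finset ℕ) (l : ℕ) : (Fin P.card → ZMod q) →ₗ[ZMod q] ZMod q :=
  ∑ i, lg q l (pr P i) • LinearMap.proj i

lemma chi_apply (q : ℕ) (P : Finset ℕ) (l : ℕ) (v : Fin P.card → ZMod q) :
    chi q P l v = ∑ i, v i * lg q l (pr P i) := by
  simp [chi, LinearMap.sum_apply, mul_comm]

/-- The integer attached to a vector. -/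
noncomputable def av (q : ℕ) (P : Finset ℕ) (v : Fin P.card → ZMod q) : ℕ :=
  ∏ i, pr P i ^ (v i).val

lemma natcast_ne {l p : ℕ} (hl : l.Prime) (hp : p.Prime) (h : l ≠ p) : (p : ZMod l) ≠ 0 := by
  rw [Ne, ZMod.natCast_eq_zero_iff]
  exact fun hd => h ((Nat.prime_dvd_prime_iff_eq hl hp).1 hd)

lemma av_ne {q : ℕ} {P : Finset ℕ} (hP : ∀ p ∈ P, p.Prime) {l : ℕ} (hl : l.Prime) (hlP : l ∉ P)
    (v : Fin P.card → ZMod q) : (av q P v : ZMod l) ≠ 0 := by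
  have := Fact.mk hl
  rw [av, Nat.cast_prod]
  refine Finset.prod_ne_zero_iff.2 fun i _ => ?_
  rw [Nat.cast_pow]
  exact pow_ne_zero _ (natcast_ne hl (hP _ (pr_mem P i)) fun h => hlP (h ▸ pr_mem P i))

lemma lg_av {q : ℕ} (hq : q.Prime) {P : Finset ℕ} (hP : ∀ p ∈ P, p.Prime) {l : ℕ} (hl : l.Prime)
    (hlP : l ∉ P) (v : Fin P.card → ZMod q) : lg q l (av q P v) = chi q P l v := by
  have := Fact.mk hl
  have := Fact.mk hq
  have hne : ∀ i, (pr P i : ZMod l) ≠ 0 := fun i =>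
    natcast_ne hl (hP _ (pr_mem P i)) fun h => hlP (h ▸ pr_mem P i)
  rw [av, Nat.cast_prod, lg_prod hq hl _ _ (fun i _ => by rw [Nat.cast_pow]; exact pow_ne_zero _ (hne i)),
    chi_apply]
  refine Finset.sum_congr rfl fun i _ => ?_
  rw [Nat.cast_pow, lg_pow hq hl (hne i), ZMod.natCast_zmod_val]

lemma av_not_pow {q : ℕ} (hq : q.Prime) {P : Finset ℕ} (hP : ∀ p ∈ P, p.Prime)
    (v : Fin P.card → ZMod q) (hv : v ≠ 0) (r : ℚ) : r ^ q ≠ av q P v := by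
  have := Fact.mk hq
  intro h
  obtain ⟨j, hj⟩ := Function.ne_iff.1 hv
  have hpj := hP _ (pr_mem P j)
  have := Fact.mk hpj
  have h1 := congrArg (padicValRat (pr P j)) h
  rw [padicValRat.pow, padicValRat.of_nat, ← Nat.factorization_def _ hpj, av,
    Nat.factorization_prod fun i _ => pow_ne_zero _ (hP _ (pr_mem P i)).ne_zero,
    Finsupp.finsetSum_apply, Finset.sum_eq_single j] at h1
  · rw [hpj.factorization_pow, Finsupp.single_eq_same] at h1
    have h2 : (q : ℤ) ∣ ((v j).val : ℤ) := ⟨_, h1.symm⟩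
    have h3 := Nat.eq_zero_of_dvd_of_lt (Int.natCast_dvd_natCast.1 h2) (ZMod.val_lt _)
    exact hj ((ZMod.val_eq_zero _).1 h3)
  · intro i _ hij
    rw [(hP _ (pr_mem P i)).factorization_pow, Finsupp.single_apply, if_neg]
    exact fun h => hij (pr_inj P h)
  · simp

theorem exists_prime {q : ℕ} (hq : q.Prime) {P : Finset ℕ} (hP : ∀ p ∈ P, p.Prime)
    (χ : (Fin P.card → ZMod q) →ₗ[ZMod q] ZMod q) (hχ : χ ≠ 0) (M : ℕ) :
    ∃ l : ℕ, l.Prime ∧ M < l ∧ ∀ v, chi q P l v = 0 → χ v = 0 := by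
  classical
  have := Fact.mk hq
  by_contra hcon
  push Not at hcon
  let c : (Fin P.card → ZMod q) → ℝ := fun v => 1 - q * (if χ v = 0 then 1 else 0)
  have h1 : Good (fun l => ∑ v ∈ univ.erase 0, c v * ((rt q (av q P v) l : ℝ) - 1)) := by
    refine Good.sum _ (fun v (l : Nat.Primes) => c v * ((rt q (av q P v) l : ℝ) - 1)) fun v hv => ?_
    exact (good_rt q _ hq (av_not_pow hq hP v (Finset.ne_of_mem_erase hv))).const_mul (c v)
  have h2 : Good (fun l => ((q : ℝ) - 1) ^ 2 * if ((l : ℕ) : ZMod q) = 1 then 1 else 0) := by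
    refine h1.congr (M + ∑ p ∈ P, p) fun l hl => ?_
    have hlP : (l : ℕ) ∉ P := fun h => by
      have := Finset.single_le_sum (f := fun p => p) (fun _ _ => Nat.zero_le _) h
      omega
    by_cases hmod : ((l : ℕ) : ZMod q) = 1
    · have hrt : ∀ v, (rt q (av q P v) l : ℝ) = q * if chi q P l v = 0 then 1 else 0 := by
        intro v
        have hne := av_ne hP l.2 hlP v
        rw [rt_ite q _ l hq l.2 hmod hne, ← lg_av hq hP l.2 hlP]
        simp only [← lg_eq_zero hq l.2 hne]
        split_ifs <;> simp
      rw [if_pos hmod, mul_one]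
      obtain ⟨v1, hv1, hv2⟩ := hcon l l.2 (by omega)
      have e1 := count q (chi q P l) χ v1 hv1 hv2
      have e2 := count q 0 χ v1 rfl hv2
      have htot : ∑ v, c v * ((rt q (av q P v) l : ℝ) - 1) = 0 := by
        have e3 : ∀ v, c v * ((rt q (av q P v) l : ℝ) - 1) =
            q * ((if chi q P l v = 0 then 1 else 0) - q * (if chi q P l v = 0 ∧ χ v = 0 then 1 else 0))
            - ((if (0 : (Fin P.card → ZMod q) →ₗ[ZMod q] ZMod q) v = 0 then 1 else 0) - q * (if (0 : (Fin P.card → ZMod q) →ₗ[ZMod q] ZMod q) v = 0 ∧ χ v = 0 then 1 else 0)) := by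
          intro v
          rw [hrt]
          simp only [c, LinearMap.zero_apply, true_and, if_true]
          by_cases ha : chi q P l v = 0 <;> by_cases hb : χ v = 0 <;> simp [ha, hb] <;> ring
        simp only [e3]
        rw [Finset.sum_sub_distrib, ← Finset.mul_sum, Finset.sum_sub_distrib, Finset.sum_sub_distrib,
          ← Finset.mul_sum, ← Finset.mul_sum, Finset.sum_boole, Finset.sum_boole, Finset.sum_boole,
          Finset.sum_boole, e1, e2]
        push_cast
        ring
      rw [← Finset.add_sum_erase _ _ (mem_univ 0), hrt] at htot
      simp only [map_zero, if_true, mul_one, c] at htot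
      simp only [c]
      linarith
    · rw [if_neg hmod, mul_zero]
      refine Finset.sum_eq_zero fun v _ => ?_
      rw [rt_one q _ l hq l.2 hmod (av_ne hP l.2 hlP v)]
      simp
  have hq1 : ((q : ℝ) - 1) ≠ 0 := by
    have : (1 : ℝ) < q := by exact_mod_cast hq.one_lt
    linarith
  refine not_good q ((h2.const_mul ((((q : ℝ) - 1) ^ 2)⁻¹)).congr 0 fun l _ => ?_)
  rw [inv_mul_cancel_left₀ (pow_ne_zero 2 hq1)]

end PowRes

namespace PowRes

lemma residue_iff {q : ℕ} (hq : q.Prime) (hodd : Odd q) {P : Finset ℕ} {l : ℕ} (hl : l.Prime)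
    {u : ℤ} (hu : u ≠ 0) (hlu : ¬ (l : ℤ) ∣ u)
    (hP : ∀ p, p ∉ P → q ∣ u.natAbs.factorization p) :
    (∃ x : ℤ, (l : ℤ) ∣ x ^ q - u) ↔ chi q P l (vecOf q P u) = 0 := by
  have := Fact.mk hl
  have := Fact.mk hq
  have hun : u.natAbs ≠ 0 := Int.natAbs_ne_zero.2 hu
  have hne : ((u.natAbs : ℕ) : ZMod l) ≠ 0 := by
    rw [Ne, ZMod.natCast_eq_zero_iff]
    exact fun h => hlu (Int.natCast_dvd.2 h)
  have hpne : ∀ p ∈ u.natAbs.primeFactors, (p : ZMod l) ≠ 0 := by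
    intro p hp h
    obtain ⟨m, hm⟩ := Nat.dvd_of_mem_primeFactors hp
    rw [hm, Nat.cast_mul, h, zero_mul] at hne
    exact hne rfl
  have h1 : lg q l (u.natAbs : ZMod l) = chi q P l (vecOf q P u) := by
    rw [chi_apply]
    have e1 : ∑ i, vecOf q P u i * lg q l (pr P i) =
        ∑ p ∈ P, ((u.natAbs.factorization p : ℕ) : ZMod q) * lg q l (p : ZMod l) :=
      sum_pr P (fun p => ((u.natAbs.factorization p : ℕ) : ZMod q) * lg q l (p : ZMod l))
    rw [e1]
    conv_lhs => rw [← Nat.prod_factorization_pow_eq_self hun]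
    rw [Nat.prod_factorization_eq_prod_primeFactors, Nat.cast_prod,
      lg_prod hq hl _ _ (fun p hp => by rw [Nat.cast_pow]; exact pow_ne_zero _ (hpne p hp))]
    rw [Finset.sum_congr rfl (fun p hp => by rw [Nat.cast_pow, lg_pow hq hl (hpne p hp)])]
    have e2 : ∀ R : Finset ℕ, (∀ p, p ∉ R → ((u.natAbs.factorization p : ℕ) : ZMod q) * lg q l (p : ZMod l) = 0) →
        ∑ p ∈ R, ((u.natAbs.factorization p : ℕ) : ZMod q) * lg q l (p : ZMod l) =
        ∑ p ∈ u.natAbs.primeFactors ∪ P, ((u.natAbs.factorization p : ℕ) : ZMod q) * lg q l (p : ZMod l) ∨ ¬ R ⊆ u.natAbs.primeFactors ∪ P := by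
      intro R hR
      by_cases hsub : R ⊆ u.natAbs.primeFactors ∪ P
      · exact Or.inl (Finset.sum_subset hsub fun p _ hp => hR p hp)
      · exact Or.inr hsub
    have a1 := (e2 u.natAbs.primeFactors (fun p hp => by
      rw [← Nat.support_factorization, Finsupp.notMem_support_iff] at hp
      rw [hp]; simp)).resolve_right (not_not.2 Finset.subset_union_left)
    have a2 := (e2 P (fun p hp => by
      rw [(ZMod.natCast_eq_zero_iff _ _).2 (hP p hp), zero_mul])).resolve_right
        (not_not.2 Finset.subset_union_right)
    rw [a1, a2]
  rw [← h1, lg_eq_zero hq hl hne]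
  have h2 : (∃ x : ℤ, (l : ℤ) ∣ x ^ q - u) ↔ ∃ w : ZMod l, w ^ q = (u : ZMod l) := by
    constructor
    · rintro ⟨x, hx⟩
      refine ⟨x, ?_⟩
      rw [← ZMod.intCast_zmod_eq_zero_iff_dvd] at hx
      push_cast at hx
      exact sub_eq_zero.1 hx
    · rintro ⟨w, hw⟩
      refine ⟨(w.val : ℤ), ?_⟩
      rw [← ZMod.intCast_zmod_eq_zero_iff_dvd]
      push_cast
      rw [ZMod.natCast_zmod_val, hw, sub_self]
  rw [h2]
  have hcast : ((u.natAbs : ℕ) : ZMod l) = ((u.natAbs : ℤ) : ZMod l) := (Int.cast_natCast _).symm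
  rw [hcast]
  rcases Int.natAbs_eq u with h | h
  · rw [← h]
  · have h' : ((u.natAbs : ℤ)) = -u := by omega
    rw [h']
    push_cast
    constructor
    · rintro ⟨w, hw⟩; exact ⟨-w, by rw [hodd.neg_pow, hw]⟩
    · rintro ⟨w, hw⟩; exact ⟨-w, by rw [hodd.neg_pow, hw, neg_neg]⟩

lemma hensel {q l : ℕ} (hq : q.Prime) (hl : l.Prime) (hlq : l ≠ q) {t : ℤ} (hlt : ¬ (l : ℤ) ∣ t)
    (h : ∃ x : ℤ, (l : ℤ) ∣ x ^ q - t) (n : ℕ) : ∃ x : ℤ, ((l : ℤ) ^ (n + 1)) ∣ x ^ q - t := by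
  have hlp : Prime (l : ℤ) := Nat.prime_iff_prime_int.1 hl
  induction n with
  | zero => simpa using h
  | succ n ih =>
    obtain ⟨x, c, hc⟩ := ih
    have hlx : ¬ (l : ℤ) ∣ x := by
      intro hd
      apply hlt
      have h1 : (l : ℤ) ∣ x ^ q := dvd_pow hd hq.ne_zero
      have h2 : (l : ℤ) ∣ x ^ q - t := by rw [hc, pow_succ]; exact ⟨(l : ℤ) ^ n * c, by ring⟩
      exact (dvd_sub_right h1).1 h2
    have hndvd : ¬ (l : ℤ) ∣ q * x ^ (q - 1) := by
      intro hd
      rcases hlp.dvd_or_dvd hd with h1 | h1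
      · exact hlq ((Nat.prime_dvd_prime_iff_eq hl hq).1 (Int.natCast_dvd_natCast.1 h1))
      · exact hlx (hlp.dvd_of_dvd_pow h1)
    have hco : IsCoprime (l : ℤ) (q * x ^ (q - 1)) :=
      (Prime.coprime_iff_not_dvd hlp).2 hndvd
    obtain ⟨a, b, hab⟩ := hco
    obtain ⟨k, hk⟩ := Polynomial.powAddExpansion x ((l : ℤ) ^ (n + 1) * (-c * b)) q
    refine ⟨x + (l : ℤ) ^ (n + 1) * (-c * b), c * a + k * (l : ℤ) ^ n * (-c * b) ^ 2, ?_⟩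
    rw [hk]
    linear_combination hc + (-(l : ℤ) ^ (n + 1) * c) * hab

lemma crt {q : ℕ} (hq : q.Prime) {t : ℤ} (N : ℕ) (hN : 0 < N)
    (h : ∀ l : ℕ, l.Prime → l ∣ N → l ≠ q ∧ ¬ (l : ℤ) ∣ t ∧ ∃ x : ℤ, (l : ℤ) ∣ x ^ q - t) :
    ∃ x : ℤ, (N : ℤ) ∣ x ^ q - t := by
  induction N using Nat.recOnPosPrimePosCoprime with
  | zero => omega
  | one => exact ⟨0, by simp⟩
  | prime_pow l n hl hn =>
    obtain ⟨h1, h2, h3⟩ := h l hl (dvd_pow_self l (by omega))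
    obtain ⟨x, hx⟩ := hensel hq hl h1 h2 h3 (n - 1)
    refine ⟨x, ?_⟩
    rw [Nat.sub_add_cancel hn] at hx
    simpa using hx
  | coprime a b ha hb hab iha ihb =>
    obtain ⟨x, hx⟩ := iha (by omega) fun l hl hd => h l hl (hd.mul_right b)
    obtain ⟨y, hy⟩ := ihb (by omega) fun l hl hd => h l hl (hd.mul_left a)
    have hco : IsCoprime (a : ℤ) (b : ℤ) := Nat.isCoprime_iff_coprime.2 hab
    obtain ⟨u, v, huv⟩ := id hco
    refine ⟨x * (v * b) + y * (u * a), ?_⟩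
    push_cast
    refine hco.mul_dvd ?_ ?_
    · have h1 : (a : ℤ) ∣ (x * (v * b) + y * (u * a)) - x :=
        ⟨u * (y - x), by linear_combination x * huv⟩
      have h2 := (h1.trans (sub_dvd_pow_sub_pow _ _ q)).add hx
      simpa using h2
    · have h1 : (b : ℤ) ∣ (x * (v * b) + y * (u * a)) - y :=
        ⟨v * (x - y), by linear_combination y * huv⟩
      have h2 := (h1.trans (sub_dvd_pow_sub_pow _ _ q)).add hy
      simpa using h2

lemma length_prod_le (F : Finset ℕ) (m : ℕ → ℕ) (hm : ∀ l ∈ F, m l = 1 ∨ (m l).Prime) :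
    (∏ l ∈ F, m l).primeFactorsList.length ≤ F.card := by
  classical
  induction F using Finset.induction_on with
  | empty => simp
  | insert i F hi ih =>
    have ih' := ih fun l hl => hm l (by simp [hl])
    rw [Finset.prod_insert hi, Finset.card_insert_of_notMem hi]
    have h0 : ∏ l ∈ F, m l ≠ 0 := Finset.prod_ne_zero_iff.2 fun l hl => by
      rcases hm l (by simp [hl]) with h | h
      · omega
      · exact h.ne_zero
    rcases hm i (by simp) with h | h
    · rw [h, one_mul]; omega
    · rw [(Nat.perm_primeFactorsList_mul h.ne_zero h0).length_eq, List.length_append,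
        Nat.primeFactorsList_prime h]
      simp only [List.length_singleton]
      omega

lemma prime_of_mem_qPrimes {q : ℕ} {S : Finset ℤ} {p : ℕ} (hp : p ∈ qPrimes q S) : p.Prime := by
  rw [qPrimes, Finset.mem_sup] at hp
  obtain ⟨s, _, hs⟩ := hp
  exact Nat.prime_of_mem_primeFactors (Finset.mem_filter.1 hs).1

lemma dvd_of_notMem_qPrimes {q : ℕ} {S : Finset ℤ} {u : ℤ} (hu : u ∈ S) {p : ℕ}
    (hp : p ∉ qPrimes q S) : q ∣ u.natAbs.factorization p := by
  by_contra hd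
  apply hp
  rw [qPrimes, Finset.mem_sup]
  refine ⟨u, hu, Finset.mem_filter.2 ⟨?_, hd⟩⟩
  rw [← Nat.support_factorization, Finsupp.mem_support_iff]
  intro h0
  rw [h0] at hd
  exact hd (dvd_zero _)

end PowRes


open PowRes

/-- **Proposition.** If `S ∈ 𝒯_{k,q}` and `T` is geometrically `q`-equivalent to `S`,
then `T ∈ 𝒯_{k,q}`. -/
theorem stmt5 (q k : ℕ) (hq : q.Prime) (hodd : Odd q) (hk : 1 ≤ k)
    (S T : Finset ℤ) (hS0 : ∀ s ∈ S, s ≠ 0) (hT0 : ∀ t ∈ T, t ≠ 0)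
    (hSpow : ∀ s ∈ S, ¬ IsPerfectPow q s) (hTpow : ∀ t ∈ T, ¬ IsPerfectPow q t)
    (hS : MemT q k ↑S) (hST : GeomEquiv q S T) :
    MemT q k ↑T := by
  obtain ⟨Δ, hΔ, hS⟩ := hS
  unfold GeomEquiv at hST
  have hP : ∀ p ∈ qPrimes q (S ∪ T), p.Prime := fun p hp => prime_of_mem_qPrimes hp
  have hPd : ∀ u ∈ S ∪ T, ∀ p, p ∉ qPrimes q (S ∪ T) → q ∣ u.natAbs.factorization p :=
    fun u hu p hp => dvd_of_notMem_qPrimes hu hp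
  generalize qPrimes q (S ∪ T) = P at hST hP hPd
  obtain ⟨Ψ, hΨ⟩ := hST
  refine ⟨q * ∏ t ∈ T, t.natAbs, Nat.mul_pos hq.pos
    (Finset.prod_pos fun t ht => Int.natAbs_pos.2 (hT0 t ht)), fun N hN hNk hNco => ?_⟩
  -- replace each prime factor of `N`
  have hm : ∀ l : ℕ, ∃ m : ℕ, (m = 1 ∧ ∀ v, chi q P l (Ψ v) = 0) ∨
      (m.Prime ∧ Δ + ∑ s ∈ S, s.natAbs < m ∧ ∀ v, chi q P m v = 0 → chi q P l (Ψ v) = 0) := by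
    intro l
    by_cases h0 : (chi q P l).comp Ψ.toLinearMap = 0
    · exact ⟨1, Or.inl ⟨rfl, fun v => LinearMap.congr_fun h0 v⟩⟩
    · obtain ⟨m, h1, h2, h3⟩ := exists_prime hq hP _ h0 (Δ + ∑ s ∈ S, s.natAbs)
      exact ⟨m, Or.inr ⟨h1, h2, h3⟩⟩
  choose m hm using hm
  have hm1 : ∀ l ∈ N.primeFactors, m l = 1 ∨ (m l).Prime := fun l _ =>
    (hm l).imp (fun h => h.1) (fun h => h.1)
  obtain ⟨s, hsS, x, hx⟩ := hS (∏ l ∈ N.primeFactors, m l)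
    (Finset.prod_pos fun l hl => by
      rcases hm1 l hl with h | h
      · omega
      · exact h.pos)
    ((length_prod_le _ m hm1).trans ((List.toFinset_card_le _).trans hNk))
    (Nat.Coprime.prod_left fun l _ => by
      rcases hm l with h | h
      · rw [h.1]; exact Nat.coprime_one_left _
      · refine (Nat.Prime.coprime_iff_not_dvd h.1).2 fun hd => ?_
        have := Nat.le_of_dvd hΔ hd
        omega)
  have hsS : s ∈ S := hsS
  have hker : ∀ l ∈ N.primeFactors, chi q P l (Ψ (vecOf q P s)) = 0 := by
    intro l hl
    rcases hm l with h | ⟨h1, h2, h3⟩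
    · exact h.2 _
    · apply h3
      refine (residue_iff hq hodd h1 (hS0 s hsS) ?_ (hPd s (Finset.mem_union_left T hsS))).1 ⟨x, ?_⟩
      · intro hd
        have e1 := Nat.le_of_dvd (Int.natAbs_pos.2 (hS0 s hsS)) (Int.natCast_dvd.1 hd)
        have e2 := Finset.single_le_sum (f := fun s : ℤ => s.natAbs) (fun _ _ => Nat.zero_le _) hsS
        omega
      · exact (Int.natCast_dvd_natCast.2 (Finset.dvd_prod_of_mem m hl)).trans hx
  have hmem : Submodule.map Ψ.toLinearMap (projPoint (vecOf q P s)) ∈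
      {Q | ∃ t ∈ T, Q = projPoint (vecOf q P t)} := by
    rw [← hΨ]
    exact ⟨_, ⟨s, hsS, rfl⟩, rfl⟩
  obtain ⟨t, htT, ht⟩ := hmem
  have hvt : vecOf q P t ∈ Submodule.map Ψ.toLinearMap (projPoint (vecOf q P s)) := by
    rw [ht]; exact Submodule.mem_span_singleton_self _
  obtain ⟨w, hw, hwt⟩ := hvt
  obtain ⟨c, rfl⟩ := Submodule.mem_span_singleton.1 hw
  refine ⟨t, htT, crt hq N hN fun l hl hlN => ?_⟩
  have hco : Nat.Coprime l (q * ∏ t ∈ T, t.natAbs) := Nat.Coprime.coprime_dvd_left hlN hNco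
  have hlq : l ≠ q := fun h => by
    subst h
    exact hl.one_lt.ne' (Nat.Coprime.eq_one_of_dvd hco (dvd_mul_right _ _))
  have hlt : ¬ (l : ℤ) ∣ t := fun h => by
    have h1 : l ∣ t.natAbs := Int.natCast_dvd.1 h
    have h2 : t.natAbs ∣ ∏ t ∈ T, t.natAbs := Finset.dvd_prod_of_mem (fun t : ℤ => t.natAbs) htT
    exact hl.one_lt.ne' (Nat.Coprime.eq_one_of_dvd hco ((h1.trans h2).mul_left q))
  refine ⟨hlq, hlt, (residue_iff hq hodd hl (hT0 t htT) hlt (hPd t (Finset.mem_union_right S htT))).2 ?_⟩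
  rw [← hwt]
  have := hker l (Nat.mem_primeFactors.2 ⟨hl, hlN, hN.ne'⟩)
  simp only [LinearEquiv.coe_coe, map_smul]
  rw [this, smul_zero]
end

section
/- Let q be an odd prime, k ≥ 1, and p_1, …, p_n distinct primes. Let ν_{ij} be natural numbers (1 ≤ i ≤ n, 1 ≤ j ≤ ℓ) such that the set S = {∏_{i=1}^{n} p_i^{ν_{ij}} : 1 ≤ j ≤ ℓ} contains no perfect q-th power, and assume S belongs to 𝒯_{k,q}. Then for every choice of b_1, …, b_n ∈ {1, …, q−1}, the set {∏_{i=1}^{n} p_i^{b_i ν_{ij}} : 1 ≤ j ≤ ℓ} belongs to 𝒯_{k,q}. -/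
open Finset

section Analytic
open Filter Topology NumberField

/-- weight of an ideal -/
noncomputable def wt {K : Type*} [Field K] [NumberField K] (s : ℝ) (I : Ideal (𝓞 K)) : ℝ :=
  (Ideal.absNorm I : ℝ) ^ (-s)

lemma wt_nonneg {K : Type*} [Field K] [NumberField K] (s : ℝ) (I : Ideal (𝓞 K)) : 0 ≤ wt s I := by
  unfold wt; positivity

lemma zeta_hasSum (K : Type*) [Field K] [NumberField K] (s : ℝ) (hs : 1 < s)
    (hz : dedekindZeta K s ≠ 0) :
    ∃ z : ℝ, (z : ℂ) = dedekindZeta K s ∧ HasSum (fun I : Ideal (𝓞 K) => wt s I) z := by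
  have hsum : LSeriesSummable (fun n ↦ (Nat.card {I : Ideal (𝓞 K) // Ideal.absNorm I = n} : ℂ)) s := by
    by_contra h
    exact hz (LSeries.eq_zero_of_not_LSeriesSummable _ _ h)
  have hterm : ∀ n, LSeries.term (fun n ↦ (Nat.card {I : Ideal (𝓞 K) // Ideal.absNorm I = n} : ℂ)) s n
      = (((Nat.card {I : Ideal (𝓞 K) // Ideal.absNorm I = n} : ℝ) * (n : ℝ) ^ (-s) : ℝ) : ℂ) := by
    intro n
    rw [LSeries.term_of_ne_zero' (by simpa using (by linarith : s ≠ 0))]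
    rw [Real.rpow_neg (by positivity), Complex.ofReal_mul, Complex.ofReal_inv,
      Complex.ofReal_cpow (by positivity)]
    simp [div_eq_mul_inv]
  have hR : Summable (fun n : ℕ => (Nat.card {I : Ideal (𝓞 K) // Ideal.absNorm I = n} : ℝ) * (n : ℝ) ^ (-s)) := by
    have := hsum
    unfold LSeriesSummable at this
    simp_rw [funext hterm] at this
    exact Complex.summable_ofReal.mp this
  have hfib : ∀ n : ℕ, HasSum (fun I : {I : Ideal (𝓞 K) // Ideal.absNorm I = n} => wt s I.1)
      ((Nat.card {I : Ideal (𝓞 K) // Ideal.absNorm I = n} : ℝ) * (n : ℝ) ^ (-s)) := by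
    intro n
    have : Finite {I : Ideal (𝓞 K) // Ideal.absNorm I = n} :=
      (Ideal.finite_setOfPred_absNorm_eq (S := 𝓞 K) n)
    have := Fintype.ofFinite {I : Ideal (𝓞 K) // Ideal.absNorm I = n}
    have hh := hasSum_fintype (fun I : {I : Ideal (𝓞 K) // Ideal.absNorm I = n} => wt s I.1)
    convert hh using 1
    rw [Finset.sum_congr rfl (g := fun _ => (n : ℝ) ^ (-s))]
    · simp
    · rintro ⟨I, hI⟩ _
      simp [wt, hI]
  have hS : Summable (fun x : (Σ n, {I : Ideal (𝓞 K) // Ideal.absNorm I = n}) => wt s x.2.1) := by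
    rw [summable_sigma_of_nonneg (fun x => wt_nonneg _ _)]
    refine ⟨fun n => (hfib n).summable, ?_⟩
    refine hR.congr fun n => ?_
    exact ((hfib n).tsum_eq).symm
  refine ⟨∑' n : ℕ, (Nat.card {I : Ideal (𝓞 K) // Ideal.absNorm I = n} : ℝ) * (n : ℝ) ^ (-s), ?_, ?_⟩
  · rw [Complex.ofReal_tsum, dedekindZeta, LSeries]
    exact (tsum_congr hterm).symm
  · have h1 := (hS.hasSum.sigma hfib)
    rw [h1.tsum_eq]
    exact (Equiv.hasSum_iff (Equiv.sigmaFiberEquiv (fun I : Ideal (𝓞 K) => Ideal.absNorm I))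
      (f := fun I => wt s I)).mp hS.hasSum

lemma zeta_facts (K : Type*) [Field K] [NumberField K] :
    ∃ (Z : ℝ → ℝ) (ρ : ℝ), 0 < ρ ∧ Tendsto (fun s => (s - 1) * Z s) (𝓝[>] 1) (𝓝 ρ) ∧
      ∀ᶠ s in 𝓝[>] (1 : ℝ), HasSum (fun I : Ideal (𝓞 K) => wt s I) (Z s) := by
  have h := tendsto_sub_one_mul_dedekindZeta_nhdsGT K
  have hne : ∀ᶠ s : ℝ in 𝓝[>] 1, dedekindZeta K s ≠ 0 := by
    have := h.eventually_ne (b₂ := 0)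
      (by exact_mod_cast dedekindZeta_residue_ne_zero K)
    filter_upwards [this] with s hs h0
    simp [h0] at hs
  refine ⟨fun s => (dedekindZeta K s).re, dedekindZeta_residue K, dedekindZeta_residue_pos K, ?_, ?_⟩
  · have := (Complex.continuous_re.tendsto _).comp h
    simp only [Complex.ofReal_re] at this
    refine this.congr fun s => ?_
    simp only [Function.comp]
    rw [← Complex.ofReal_one, ← Complex.ofReal_sub, Complex.re_ofReal_mul]
  · filter_upwards [hne, self_mem_nhdsWithin] with s hs h1
    obtain ⟨z, hz, hz2⟩ := zeta_hasSum K s h1 hs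
    simp only [← hz, Complex.ofReal_re]
    exact hz2

lemma prime_norm_ge_two {K : Type*} [Field K] [NumberField K] {P : Ideal (𝓞 K)}
    (hP : Prime P) : 2 ≤ Ideal.absNorm P := by
  have h0 : Ideal.absNorm P ≠ 0 := by
    rw [Ne, Ideal.absNorm_eq_zero_iff]; exact hP.ne_zero
  have h1 : Ideal.absNorm P ≠ 1 := by
    rw [Ne, Ideal.absNorm_eq_one_iff]
    intro h
    exact hP.not_isUnit (Ideal.isUnit_iff.mpr h)
  omega

lemma wt_mul {K : Type*} [Field K] [NumberField K] (s : ℝ) (I J : Ideal (𝓞 K)) :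
    wt s (I * J) = wt s I * wt s J := by
  simp [wt, Real.mul_rpow]

lemma wt_one {K : Type*} [Field K] [NumberField K] (s : ℝ) :
    wt s (1 : Ideal (𝓞 K)) = 1 := by
  simp [wt]

/-- weight as monoid hom -/
noncomputable def wtHom (K : Type*) [Field K] [NumberField K] (s : ℝ) : Ideal (𝓞 K) →* ℝ where
  toFun := wt s
  map_one' := wt_one s
  map_mul' := wt_mul s

lemma wt_prime_le {K : Type*} [Field K] [NumberField K] {s : ℝ} (hs : 1 ≤ s) {P : Ideal (𝓞 K)}
    (hP : Prime P) : wt s P ≤ 1 / 2 := by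
  have h2 : (2 : ℝ) ≤ Ideal.absNorm P := by exact_mod_cast prime_norm_ge_two hP
  unfold wt
  calc (Ideal.absNorm P : ℝ) ^ (-s) ≤ (Ideal.absNorm P : ℝ) ^ (-1 : ℝ) :=
        Real.rpow_le_rpow_of_exponent_le (by linarith) (by linarith)
    _ ≤ 1 / 2 := by
        rw [Real.rpow_neg_one, one_div]
        gcongr

lemma lower_aux {K : Type*} [Field K] [NumberField K] {s z : ℝ} (hs : 1 ≤ s)
    (hz : HasSum (fun I : Ideal (𝓞 K) => wt s I) z) (T : Finset (Ideal (𝓞 K)))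
    (hT : ∀ P ∈ T, Prime P) :
    Real.exp (∑ P ∈ T, wt s P - ∑ P ∈ T, wt s P ^ 2) ≤ z := by
  classical
  calc Real.exp (∑ P ∈ T, wt s P - ∑ P ∈ T, wt s P ^ 2)
      = ∏ P ∈ T, Real.exp (wt s P - wt s P ^ 2) := by
        rw [← Real.exp_sum, Finset.sum_sub_distrib]
    _ ≤ ∏ P ∈ T, (1 + wt s P) := by
        refine Finset.prod_le_prod (fun _ _ => (Real.exp_pos _).le) fun P hP => ?_
        have h0 := wt_nonneg s P
        have h1 := wt_prime_le hs (hT P hP)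
        set x := wt s P
        have h3 := Real.one_sub_le_exp_neg (x - x ^ 2)
        rw [Real.exp_neg] at h3
        have hpos := Real.exp_pos (x - x ^ 2)
        have h4 : (1 - (x - x ^ 2)) * Real.exp (x - x ^ 2) ≤ 1 := by
          calc _ ≤ (Real.exp (x - x ^ 2))⁻¹ * Real.exp (x - x ^ 2) := by gcongr
            _ = 1 := by field_simp
        have h5 : 0 < 1 - (x - x ^ 2) := by nlinarith
        have h6 : (1 : ℝ) ≤ (1 - (x - x ^ 2)) * (1 + x) := by
          have : 0 ≤ x ^ 3 := by positivity
          nlinarith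
        have := h4.trans h6
        exact le_of_mul_le_mul_left this h5
    _ = ∑ A ∈ T.powerset, wt s (∏ P ∈ A, P) := by
        rw [Finset.prod_one_add]
        refine Finset.sum_congr rfl fun A _ => ?_
        exact (map_prod (wtHom K s) _ _).symm
    _ = ∑ I ∈ T.powerset.image (fun A => ∏ P ∈ A, P), wt s I := by
        rw [Finset.sum_image]
        have key : ∀ A ∈ T.powerset, ∀ Q ∈ T, (Q ∣ ∏ P ∈ A, P) → Q ∈ A := by
          intro A hA Q hQ hd
          obtain ⟨P, hP, hQP⟩ := (Prime.dvd_finsetProd_iff (hT Q hQ) _).mp hd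
          have := (hT Q hQ).associated_of_dvd (hT P (Finset.mem_powerset.mp hA hP)) hQP
          rw [associated_iff_eq] at this
          rwa [this]
        intro A hA B hB hAB
        simp only at hAB
        have hA' := Finset.mem_powerset.mp hA
        have hB' := Finset.mem_powerset.mp hB
        ext Q
        constructor
        · intro h
          exact key B hB Q (hA' h) (hAB ▸ Finset.dvd_prod_of_mem _ h)
        · intro h
          exact key A hA Q (hB' h) (hAB ▸ Finset.dvd_prod_of_mem _ h)
    _ ≤ z := sum_le_hasSum _ (fun I _ => wt_nonneg s I) hz

lemma upper_aux {K : Type*} [Field K] [NumberField K] {s z : ℝ} (hs : 1 ≤ s)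
    (hz : HasSum (fun I : Ideal (𝓞 K) => wt s I) z) (X : ℝ)
    (hX : ∀ T : Finset (Ideal (𝓞 K)), (∀ P ∈ T, Prime P) → ∑ P ∈ T, (wt s P + wt s P ^ 2) ≤ X) :
    z ≤ Real.exp X := by
  classical
  refine hasSum_le_of_sum_le hz fun J => ?_
  have hJ0 : ∑ I ∈ J, wt s I = ∑ I ∈ J.filter (fun I => I ≠ 0), wt s I := by
    rw [Finset.sum_filter]
    refine Finset.sum_congr rfl fun I _ => ?_
    split_ifs with h
    · rfl
    · push Not at h
      subst h
      simp [wt, Real.zero_rpow (show (-s) ≠ 0 by linarith)]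
  rw [hJ0]
  set J' := J.filter (fun I => I ≠ 0)
  let fac : Ideal (𝓞 K) → Multiset (Ideal (𝓞 K)) := fun I => UniqueFactorizationMonoid.normalizedFactors I
  let T : Finset (Ideal (𝓞 K)) := J'.biUnion fun I => (fac I).toFinset
  have hT : ∀ P ∈ T, Prime P := by
    intro P hP
    simp only [T, Finset.mem_biUnion, Multiset.mem_toFinset] at hP
    obtain ⟨I, _, hP⟩ := hP
    exact UniqueFactorizationMonoid.prime_of_normalized_factor P hP
  let M : ℕ := (J'.sup fun I => (fac I).card) + 1
  have hprod : ∀ I ∈ J', I = ∏ P : T, P.1 ^ ((fac I).count P.1) := by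
    intro I hI
    have hI0 : I ≠ 0 := (Finset.mem_filter.mp hI).2
    have h1 : (fac I).prod = I := by
      have := UniqueFactorizationMonoid.prod_normalizedFactors hI0
      rwa [associated_iff_eq] at this
    have h2 : (fac I).toFinset ⊆ T := Finset.subset_biUnion_of_mem (fun I => (fac I).toFinset) hI
    rw [Finset.prod_coe_sort T (fun P => P ^ ((fac I).count P)),
      ← Finset.prod_multiset_count_of_subset _ _ h2, h1]
  calc ∑ I ∈ J', wt s I = ∑ I ∈ J', ∏ P : T, wt s P.1 ^ ((fac I).count P.1) := by
        refine Finset.sum_congr rfl fun I hI => ?_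
        conv_lhs => rw [hprod I hI]
        have := map_prod (wtHom K s) (fun P : T => P.1 ^ ((fac I).count P.1)) Finset.univ
        simp only [map_pow] at this
        exact this
    _ = ∑ x ∈ J'.image (fun I => fun P : T => (fac I).count P.1), ∏ P : T, wt s P.1 ^ (x P) := by
        rw [Finset.sum_image]
        intro I hI I' hI' h
        rw [hprod I hI, hprod I' hI']
        refine Finset.prod_congr rfl fun P _ => ?_
        have := congrFun h P
        simp only at this
        rw [this]
    _ ≤ ∑ x ∈ Fintype.piFinset (fun _ : T => Finset.range M), ∏ P : T, wt s P.1 ^ (x P) := by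
        refine Finset.sum_le_sum_of_subset_of_nonneg ?_ ?_
        · intro x hx
          obtain ⟨I, hI, rfl⟩ := Finset.mem_image.mp hx
          rw [Fintype.mem_piFinset]
          intro P
          rw [Finset.mem_range]
          have h1 : (fac I).count P.1 ≤ (fac I).card := Multiset.count_le_card _ _
          have h2 : (fac I).card ≤ J'.sup fun I => (fac I).card :=
            Finset.le_sup (f := fun I => (fac I).card) hI
          simp only [M]
          omega
        · intro x _ _
          exact Finset.prod_nonneg fun P _ => pow_nonneg (wt_nonneg _ _) _
    _ = ∏ P : T, ∑ e ∈ Finset.range M, wt s P.1 ^ e := by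
        rw [Finset.prod_univ_sum]
    _ ≤ ∏ P : T, Real.exp (wt s P.1 + wt s P.1 ^ 2) := by
        refine Finset.prod_le_prod (fun P _ => Finset.sum_nonneg fun e _ => pow_nonneg (wt_nonneg _ _) _)
          fun P _ => ?_
        have h0 := wt_nonneg s P.1
        have h1 := wt_prime_le hs (hT P.1 P.2)
        set x := wt s P.1
        have h2 : (∑ e ∈ Finset.range M, x ^ e) * (1 - x) ≤ 1 := by
          rw [geom_sum_mul_neg]
          have : 0 ≤ x ^ M := by positivity
          linarith
        have h3 := Real.quadratic_le_exp_of_nonneg (show 0 ≤ x + x ^ 2 by positivity)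
        have h4 : 1 ≤ Real.exp (x + x ^ 2) * (1 - x) := by
          refine le_trans ?_ (mul_le_mul_of_nonneg_right h3 (by linarith : 0 ≤ 1 - x))
          have : 0 ≤ x ^ 2 * (1 - x - x ^ 2 - x ^ 3) := by
            have h5 : x ^ 2 ≤ 1 / 4 := by nlinarith
            have h6 : x ^ 3 ≤ 1 / 8 := by nlinarith [sq_nonneg x]
            have : 0 ≤ 1 - x - x ^ 2 - x ^ 3 := by linarith
            positivity
          nlinarith
        exact le_of_mul_le_mul_right (h2.trans h4) (by linarith)
    _ = Real.exp (∑ P ∈ T, (wt s P + wt s P ^ 2)) := by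
        rw [← Real.exp_sum, Finset.sum_coe_sort T (fun P => wt s P + wt s P ^ 2)]
    _ ≤ Real.exp X := Real.exp_le_exp.mpr (hX T hT)

lemma squares_bdd (K : Type*) [Field K] [NumberField K] :
    ∃ C : ℝ, ∀ s : ℝ, 1 ≤ s → ∀ T : Finset (Ideal (𝓞 K)), (∀ P ∈ T, Prime P) →
      ∑ P ∈ T, wt s P ^ 2 ≤ C := by
  obtain ⟨Z, ρ, -, -, hZ⟩ := zeta_facts K
  have h2 : ∀ᶠ s in 𝓝[>] (1 : ℝ), s < 2 := by
    filter_upwards [Ioo_mem_nhdsGT (show (1 : ℝ) < 2 by norm_num)] with s hs using hs.2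
  obtain ⟨t, ht, ht2⟩ := (hZ.and h2).exists
  refine ⟨Z t, fun s hs T hT => ?_⟩
  refine le_trans (Finset.sum_le_sum fun P hP => ?_) (sum_le_hasSum T (fun I _ => wt_nonneg t I) ht)
  have : (1 : ℝ) ≤ Ideal.absNorm P := by
    have := prime_norm_ge_two (hT P hP)
    exact_mod_cast (by omega : 1 ≤ Ideal.absNorm P)
  unfold wt
  rw [← Real.rpow_natCast, ← Real.rpow_mul (by positivity)]
  apply Real.rpow_le_rpow_of_exponent_le this
  push_cast
  linarith
end Analytic

section Analytic2
open Filter Topology NumberField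

lemma prime_norm_primePow {K : Type*} [Field K] [NumberField K] {P : Ideal (𝓞 K)}
    (hP : Prime P) : ∃ p f : ℕ, p.Prime ∧ 0 < f ∧ p ^ f = Ideal.absNorm P ∧ ((p : 𝓞 K) ∈ P) := by
  have hprime : P.IsPrime := Ideal.isPrime_of_prime hP
  have hmax : P.IsMaximal := hprime.isMaximal hP.ne_zero
  let _ : Field (𝓞 K ⧸ P) := Ideal.Quotient.field P
  have : Finite (𝓞 K ⧸ P) := Ideal.finiteQuotientOfFreeOfNeBot P hP.ne_zero
  have := Fintype.ofFinite (𝓞 K ⧸ P)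
  obtain ⟨p, f, hp, hf, h⟩ := FiniteField.isPrimePow_card (𝓞 K ⧸ P)
  have hN : p ^ f = Ideal.absNorm P := by
    rw [h, Ideal.absNorm_apply, Submodule.cardQuot_apply, Nat.card_eq_fintype_card]
  refine ⟨p, f, hp.nat_prime, hf, hN, ?_⟩
  have := Ideal.absNorm_mem P
  rw [← hN, Nat.cast_pow] at this
  exact hprime.mem_of_pow_mem _ this

lemma card_primes_containing {K : Type*} [Field K] [NumberField K] {p : ℕ} (hp : p.Prime)
    (T : Finset (Ideal (𝓞 K))) (hT : ∀ P ∈ T, Prime P ∧ (p : 𝓞 K) ∈ P) :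
    T.card ≤ Module.finrank ℚ K := by
  classical
  have hpz : Prime (p : ℤ) := Nat.prime_iff_prime_int.mp hp
  have h0 : (Ideal.span {(p : ℤ)}) ≠ ⊥ := by
    simpa using hp.ne_zero
  have : (Ideal.span {(p : ℤ)}).IsMaximal :=
    ((Ideal.span_singleton_prime hpz.ne_zero).mpr hpz).isMaximal h0
  refine le_trans (Finset.card_le_card ?_)
    (Ideal.card_primesOverFinset_le_finrank (𝓞 K) ℚ K h0)
  intro P hP
  rw [IsDedekindDomain.mem_primesOverFinset_iff h0]
  obtain ⟨h1, h2⟩ := hT P hP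
  have hPp := Ideal.isPrime_of_prime h1
  refine ⟨hPp, ⟨?_⟩⟩
  refine Ideal.IsMaximal.eq_of_le inferInstance (Ideal.IsPrime.ne_top (hPp.comap _)) ?_
  rw [Ideal.span_singleton_le_iff_mem]
  simpa using h2

lemma bad_bdd (K : Type*) [Field K] [NumberField K] (Δ : ℕ) (hΔ : Δ ≠ 0) :
    ∃ C : ℝ, ∀ s : ℝ, 1 ≤ s → ∀ T : Finset (Ideal (𝓞 K)), (∀ P ∈ T, Prime P ∧
      ¬ ((Ideal.absNorm P).Prime ∧ ¬ Ideal.absNorm P ∣ Δ)) →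
      ∑ P ∈ T, wt s P ≤ C := by
  classical
  have hsq : Summable (fun n : ℕ => ((n : ℝ) ^ 2)⁻¹) := by
    simp
  have hfin : Summable (fun n : ℕ => if n ∈ Δ.divisors then (1 : ℝ) else 0) :=
    summable_of_ne_finset_zero (s := Δ.divisors) (fun n hn => by simp only [if_neg hn])
  have hg := hsq.add hfin
  set g : ℕ → ℝ := fun n => ((n : ℝ) ^ 2)⁻¹ + (if n ∈ Δ.divisors then (1 : ℝ) else 0) with hgdef
  have hg0 : ∀ n, 0 ≤ g n := by
    intro n; simp only [hgdef]; split_ifs <;> positivity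
  refine ⟨(Module.finrank ℚ K) * ∑' n, g n, fun s hs T hT => ?_⟩
  choose! p f hp hf hN hmem using fun (P : Ideal (𝓞 K)) (hP : Prime P) => prime_norm_primePow hP
  have hle : ∀ P ∈ T, wt s P ≤ g (p P) := by
    intro P hP
    obtain ⟨h1, h2⟩ := hT P hP
    have hge := prime_norm_ge_two h1
    have hge' : (1 : ℝ) ≤ Ideal.absNorm P := by exact_mod_cast (by omega : 1 ≤ Ideal.absNorm P)
    by_cases hf1 : f P = 1
    · have hpn := hN P h1
      rw [hf1, pow_one] at hpn
      have hd : Ideal.absNorm P ∣ Δ := by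
        by_contra h
        exact h2 ⟨hpn ▸ hp P h1, h⟩
      have : g (p P) ≥ 1 := by
        simp only [hgdef]
        rw [if_pos (by rw [hpn]; exact Nat.mem_divisors.mpr ⟨hd, hΔ⟩)]
        have : (0 : ℝ) ≤ ((p P : ℝ) ^ 2)⁻¹ := by positivity
        linarith
      have := wt_prime_le hs h1
      linarith
    · have hf2 : 2 ≤ f P := by have := hf P h1; omega
      have h3 : wt s P ≤ ((p P : ℝ) ^ 2)⁻¹ := by
        unfold wt
        calc (Ideal.absNorm P : ℝ) ^ (-s) ≤ (Ideal.absNorm P : ℝ) ^ (-1 : ℝ) :=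
              Real.rpow_le_rpow_of_exponent_le hge' (by linarith)
          _ = ((p P : ℝ) ^ f P)⁻¹ := by
              rw [Real.rpow_neg_one, ← hN P h1]; push_cast; rfl
          _ ≤ _ := by
              have h1p : (1 : ℝ) ≤ p P := by exact_mod_cast (hp P h1).one_le
              have : (0 : ℝ) < p P := by linarith
              gcongr
      refine h3.trans ?_
      simp only [hgdef]
      split_ifs <;> simp
  calc ∑ P ∈ T, wt s P ≤ ∑ P ∈ T, g (p P) := Finset.sum_le_sum hle
    _ = ∑ n ∈ T.image p, ((T.filter (fun P => p P = n)).card : ℝ) * g n := by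
        rw [Finset.sum_comp]
        simp
    _ ≤ ∑ n ∈ T.image p, (Module.finrank ℚ K : ℝ) * g n := by
        refine Finset.sum_le_sum fun n hn => ?_
        obtain ⟨P, hP, rfl⟩ := Finset.mem_image.mp hn
        refine mul_le_mul_of_nonneg_right ?_ (hg0 _)
        have := card_primes_containing (K := K) (hp P (hT P hP).1) (T.filter (fun Q => p Q = p P)) (by
          intro Q hQ
          rw [Finset.mem_filter] at hQ
          exact ⟨(hT Q hQ.1).1, hQ.2 ▸ hmem Q (hT Q hQ.1).1⟩)
        exact_mod_cast this
    _ = (Module.finrank ℚ K : ℝ) * ∑ n ∈ T.image p, g n := by rw [Finset.mul_sum]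
    _ ≤ _ := by
        gcongr
        exact hg.sum_le_tsum _ (fun n _ => hg0 n)

theorem no_double_cover (F L : Type*) [Field F] [NumberField F] [Field L] [NumberField L]
    [Algebra (𝓞 F) (𝓞 L)] (Δ : ℕ) (hΔ : Δ ≠ 0)
    (H : ∀ P : Ideal (𝓞 F), Prime P → (Ideal.absNorm P).Prime → ¬ Ideal.absNorm P ∣ Δ →
      ∃ Q₁ Q₂ : Ideal (𝓞 L), Q₁ ≠ Q₂ ∧ Prime Q₁ ∧ Prime Q₂ ∧
        Q₁.comap (algebraMap (𝓞 F) (𝓞 L)) = P ∧ Q₂.comap (algebraMap (𝓞 F) (𝓞 L)) = P ∧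
        Ideal.absNorm Q₁ = Ideal.absNorm P ∧ Ideal.absNorm Q₂ = Ideal.absNorm P) : False := by
  classical
  obtain ⟨ZF, ρF, hρF, htF, hZF⟩ := zeta_facts F
  obtain ⟨ZL, ρL, hρL, htL, hZL⟩ := zeta_facts L
  obtain ⟨CF, hCF⟩ := squares_bdd F
  obtain ⟨CL, hCL⟩ := squares_bdd L
  obtain ⟨CB, hCB⟩ := bad_bdd F Δ hΔ
  choose! Q₁ Q₂ hne hp1 hp2 hc1 hc2 hn1 hn2 using H
  have key : ∀ᶠ s in 𝓝[>] (1 : ℝ), ZF s ^ 2 ≤ Real.exp (CL + 2 * CB + 2 * CF) * ZL s := by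
    filter_upwards [hZF, hZL, self_mem_nhdsWithin] with s h1 h2 hs
    have hs1 : (1 : ℝ) ≤ s := le_of_lt hs
    have hZLpos : 0 < ZL s := lt_of_lt_of_le (Real.exp_pos _) (lower_aux hs1 h2 ∅ (by simp))
    have hZF0 : 0 ≤ ZF s := h1.nonneg (fun I => wt_nonneg s I)
    have hgood : ∀ T : Finset (Ideal (𝓞 F)), (∀ P ∈ T, Prime P ∧ (Ideal.absNorm P).Prime ∧
        ¬ Ideal.absNorm P ∣ Δ) → 2 * ∑ P ∈ T, wt s P ≤ Real.log (ZL s) + CL := by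
      intro T hT
      have hinj1 : Set.InjOn Q₁ T := by
        intro P hP P' hP' h
        obtain ⟨a, b, c⟩ := hT P hP
        obtain ⟨a', b', c'⟩ := hT P' hP'
        rw [← hc1 P a b c, ← hc1 P' a' b' c', h]
      have hinj2 : Set.InjOn Q₂ T := by
        intro P hP P' hP' h
        obtain ⟨a, b, c⟩ := hT P hP
        obtain ⟨a', b', c'⟩ := hT P' hP'
        rw [← hc2 P a b c, ← hc2 P' a' b' c', h]
      have hdisj : Disjoint (T.image Q₁) (T.image Q₂) := by
        rw [Finset.disjoint_left]
        intro Q hQ hQ'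
        obtain ⟨P, hP, rfl⟩ := Finset.mem_image.mp hQ
        obtain ⟨P', hP', h⟩ := Finset.mem_image.mp hQ'
        obtain ⟨a, b, c⟩ := hT P hP
        obtain ⟨a', b', c'⟩ := hT P' hP'
        have : P' = P := by rw [← hc1 P a b c, ← hc2 P' a' b' c', h]
        subst this
        exact hne P' a b c h.symm
      have hsum : ∑ Q ∈ T.image Q₁ ∪ T.image Q₂, wt s Q = 2 * ∑ P ∈ T, wt s P := by
        rw [Finset.sum_union hdisj, Finset.sum_image hinj1, Finset.sum_image hinj2, two_mul]
        congr 1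
        · refine Finset.sum_congr rfl fun P hP => ?_
          obtain ⟨a, b, c⟩ := hT P hP
          simp only [wt, hn1 P a b c]
        · refine Finset.sum_congr rfl fun P hP => ?_
          obtain ⟨a, b, c⟩ := hT P hP
          simp only [wt, hn2 P a b c]
      have hprime : ∀ Q ∈ T.image Q₁ ∪ T.image Q₂, Prime Q := by
        intro Q hQ
        rcases Finset.mem_union.mp hQ with h | h
        · obtain ⟨P, hP, rfl⟩ := Finset.mem_image.mp h
          obtain ⟨a, b, c⟩ := hT P hP
          exact hp1 P a b c
        · obtain ⟨P, hP, rfl⟩ := Finset.mem_image.mp h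
          obtain ⟨a, b, c⟩ := hT P hP
          exact hp2 P a b c
      have h3 := lower_aux hs1 h2 _ hprime
      rw [hsum] at h3
      have h4 := hCL s hs1 _ hprime
      have h5 := (Real.le_log_iff_exp_le hZLpos).mpr h3
      linarith
    have hup := upper_aux hs1 h1 ((Real.log (ZL s) + CL) / 2 + CB + CF) (by
      intro T hT
      rw [Finset.sum_add_distrib]
      have e1 := hCF s hs1 T hT
      have e2 := hgood (T.filter (fun P => (Ideal.absNorm P).Prime ∧ ¬ Ideal.absNorm P ∣ Δ)) (by
        intro P hP
        rw [Finset.mem_filter] at hP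
        exact ⟨hT P hP.1, hP.2⟩)
      have e3 := hCB s hs1 (T.filter (fun P => ¬ ((Ideal.absNorm P).Prime ∧ ¬ Ideal.absNorm P ∣ Δ))) (by
        intro P hP
        rw [Finset.mem_filter] at hP
        exact ⟨hT P hP.1, hP.2⟩)
      have e4 := Finset.sum_filter_add_sum_filter_not T
        (fun P => (Ideal.absNorm P).Prime ∧ ¬ Ideal.absNorm P ∣ Δ) (fun P => wt s P)
      linarith)
    calc ZF s ^ 2 ≤ Real.exp ((Real.log (ZL s) + CL) / 2 + CB + CF) ^ 2 := by gcongr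
      _ = Real.exp (CL + 2 * CB + 2 * CF) * Real.exp (Real.log (ZL s)) := by
          rw [← Real.exp_nat_mul, ← Real.exp_add]
          congr 1
          push_cast
          ring
      _ = _ := by rw [Real.exp_log hZLpos]
  have ht1 : Tendsto (fun s => ((s - 1) * ZF s) ^ 2) (𝓝[>] 1) (𝓝 (ρF ^ 2)) := htF.pow 2
  have hs0 : Tendsto (fun s : ℝ => s - 1) (𝓝[>] 1) (𝓝 0) := by
    have : Tendsto (fun s : ℝ => s - 1) (𝓝 1) (𝓝 (1 - 1)) := (continuous_id.sub continuous_const).tendsto 1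
    rw [sub_self] at this
    exact this.mono_left nhdsWithin_le_nhds
  have ht2 : Tendsto (fun s => Real.exp (CL + 2 * CB + 2 * CF) * ((s - 1) * ((s - 1) * ZL s)))
      (𝓝[>] 1) (𝓝 (Real.exp (CL + 2 * CB + 2 * CF) * (0 * ρL))) := (hs0.mul htL).const_mul _
  have := le_of_tendsto_of_tendsto ht1 ht2 (by
    filter_upwards [key] with s hs
    have : 0 ≤ (s - 1) ^ 2 := by positivity
    calc ((s - 1) * ZF s) ^ 2 = (s - 1) ^ 2 * ZF s ^ 2 := by ring
      _ ≤ (s - 1) ^ 2 * (Real.exp (CL + 2 * CB + 2 * CF) * ZL s) := by gcongr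
      _ = _ := by ring)
  have : 0 < ρF ^ 2 := by positivity
  simp at *
  linarith
end Analytic2

section Algebraic
open NumberField

lemma exists_multiplier (F L : Type*) [Field F] [NumberField F] [Field L] [NumberField L]
    [Algebra F L] (α : 𝓞 L) (hadj : Algebra.adjoin F {(α : L)} = ⊤) :
    ∃ m : ℤ, m ≠ 0 ∧ ∀ β : 𝓞 L, (m : 𝓞 L) * β ∈ Algebra.adjoin (𝓞 F) {α} := by
  classical
  have h1 : ∀ x : L, x ∈ Algebra.adjoin F {(α : L)} →
      ∃ m : ℤ, m ≠ 0 ∧ ∃ a ∈ Algebra.adjoin (𝓞 F) {α}, (m : L) * x = algebraMap (𝓞 L) L a := by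
    intro x hx
    induction hx using Algebra.adjoin_induction with
    | mem x hx =>
      refine ⟨1, one_ne_zero, α, Algebra.subset_adjoin rfl, ?_⟩
      rw [Set.mem_singleton_iff] at hx
      simp [hx]
    | algebraMap r =>
      have : IsAlgebraic ℤ r :=
        (IsFractionRing.isAlgebraic_iff ℤ ℚ F).mpr (Algebra.IsAlgebraic.isAlgebraic r)
      obtain ⟨y, hy, hyr⟩ := this.exists_integral_multiple
      let r' : 𝓞 F := ⟨y • r, hyr⟩
      refine ⟨y, hy, algebraMap (𝓞 F) (𝓞 L) r', Subalgebra.algebraMap_mem _ _, ?_⟩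
      have h2 : algebraMap (𝓞 L) L (algebraMap (𝓞 F) (𝓞 L) r') = algebraMap F L (r' : F) := by
        rfl
      rw [h2]
      have h3 : (r' : F) = y • r := rfl
      rw [h3]
      simp
    | add x y _ _ hx hy =>
      obtain ⟨m, hm, a, ha, h⟩ := hx
      obtain ⟨n, hn, b, hb, h'⟩ := hy
      refine ⟨m * n, mul_ne_zero hm hn, (n : 𝓞 L) * a + (m : 𝓞 L) * b, ?_, ?_⟩
      · exact add_mem (mul_mem (intCast_mem _ _) ha) (mul_mem (intCast_mem _ _) hb)
      · rw [map_add, map_mul, map_mul, map_intCast, map_intCast, ← h, ← h']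
        push_cast
        ring
    | mul x y _ _ hx hy =>
      obtain ⟨m, hm, a, ha, h⟩ := hx
      obtain ⟨n, hn, b, hb, h'⟩ := hy
      refine ⟨m * n, mul_ne_zero hm hn, a * b, mul_mem ha hb, ?_⟩
      rw [map_mul, ← h, ← h']
      push_cast
      ring
  have h2 : ∀ β : 𝓞 L, ∃ m : ℤ, m ≠ 0 ∧ (m : 𝓞 L) * β ∈ Algebra.adjoin (𝓞 F) {α} := by
    intro β
    obtain ⟨m, hm, a, ha, h⟩ := h1 (β : L) (by rw [hadj]; trivial)
    refine ⟨m, hm, ?_⟩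
    have : (m : 𝓞 L) * β = a := by
      apply RingOfIntegers.ext
      exact (by simp [← h] : algebraMap (𝓞 L) L ((m : 𝓞 L) * β) = algebraMap (𝓞 L) L a)
    rwa [this]
  choose μ hμ hμ2 using h2
  obtain ⟨S, hS⟩ := (Module.finite_def.mp (inferInstance : Module.Finite ℤ (𝓞 L)))
  refine ⟨∏ x ∈ S, μ x, Finset.prod_ne_zero_iff.mpr fun x _ => hμ x, fun β => ?_⟩
  have hβ : β ∈ Submodule.span ℤ (S : Set (𝓞 L)) := by rw [hS]; trivial
  induction hβ using Submodule.span_induction with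
  | mem x hx =>
    rw [← Finset.mul_prod_erase S μ hx]
    push_cast
    have : ((μ x : 𝓞 L) * ∏ i ∈ S.erase x, (μ i : 𝓞 L)) * x
      = (∏ i ∈ S.erase x, (μ i : 𝓞 L)) * ((μ x : 𝓞 L) * x) := by ring
    rw [this]
    exact mul_mem (prod_mem fun i _ => intCast_mem _ _) (hμ2 x)
  | zero => simp
  | add x y _ _ hx hy => rw [mul_add]; exact add_mem hx hy
  | smul a x _ hx =>
    rw [zsmul_eq_mul, mul_left_comm]
    exact mul_mem (intCast_mem _ _) hx

/-- a degree one prime: every element is congruent to an integer -/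
lemma cong_int {K : Type*} [Field K] [NumberField K] (P : Ideal (𝓞 K)) (p : ℕ)
    (hpd : Ideal.absNorm P = p) (hp : p.Prime) : ∃ φ : 𝓞 K →+* ZMod p,
      RingHom.ker φ = P := by
  subst hpd
  have hb : P ≠ ⊥ := by
    rintro rfl
    simp [Nat.not_prime_zero] at hp
  have : Finite (𝓞 K ⧸ P) := Ideal.finiteQuotientOfFreeOfNeBot P hb
  have := Fintype.ofFinite (𝓞 K ⧸ P)
  let e : ZMod (Ideal.absNorm P) ≃+* (𝓞 K ⧸ P) := ZMod.ringEquivOfPrime (𝓞 K ⧸ P) hp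
    (by rw [Ideal.absNorm_apply, Submodule.cardQuot_apply, Nat.card_eq_fintype_card])
  refine ⟨(e.symm : (𝓞 K ⧸ P) →+* ZMod (Ideal.absNorm P)).comp (Ideal.Quotient.mk P), ?_⟩
  ext x
  simp [RingHom.mem_ker, Ideal.Quotient.eq_zero_iff_mem]

lemma norm_of_cong {K : Type*} [Field K] [NumberField K] (Q : Ideal (𝓞 K)) [hQ : Q.IsPrime] (p : ℕ)
    (hp : p.Prime) (hpQ : (p : 𝓞 K) ∈ Q) (h : ∀ β : 𝓞 K, ∃ n : ℤ, β - n ∈ Q) :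
    Ideal.absNorm Q = p := by
  have : Fact p.Prime := ⟨hp⟩
  have hchar : CharP (𝓞 K ⧸ Q) p := by
    apply (CharP.charP_iff_prime_eq_zero hp).mpr
    rw [← map_natCast (Ideal.Quotient.mk Q), Ideal.Quotient.eq_zero_iff_mem]
    exact hpQ
  let f : ZMod p →+* (𝓞 K ⧸ Q) := ZMod.castHom dvd_rfl _
  have hbij : Function.Bijective f := by
    refine ⟨f.injective, fun y => ?_⟩
    obtain ⟨β, rfl⟩ := Ideal.Quotient.mk_surjective y
    obtain ⟨n, hn⟩ := h β
    refine ⟨(n : ZMod p), ?_⟩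
    rw [map_intCast, ← map_intCast (Ideal.Quotient.mk Q)]
    exact (Ideal.Quotient.eq.mpr hn).symm
  rw [Ideal.absNorm_apply, Submodule.cardQuot_apply, ← Nat.card_congr (Equiv.ofBijective f hbij)]
  simp

theorem exists_nonsplit (F L : Type*) [Field F] [NumberField F] [Field L] [NumberField L]
    [Algebra F L] (σ : L ≃ₐ[F] L) (q : ℕ) (hq : 0 < q) (ζ : 𝓞 F) (hζ : IsPrimitiveRoot ζ q)
    (u : ℤ) (α : 𝓞 L) (hα : α ^ q = u) (hadj : Algebra.adjoin F {(α : L)} = ⊤)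
    (hσ : σ α ≠ α) (Δ : ℕ) (hΔ : Δ ≠ 0) :
    ∃ p : ℕ, p.Prime ∧ ¬ p ∣ Δ ∧ ∃ φ : 𝓞 F →+* ZMod p, ¬ ∃ a : ZMod p, a ^ q = u := by
  classical
  by_contra hcon
  push Not at hcon
  obtain ⟨m, hm, hmA⟩ := exists_multiplier F L α hadj
  let τ : 𝓞 L ≃ₐ[𝓞 F] 𝓞 L := RingOfIntegers.mapAlgEquiv σ
  have hτ : τ α - α ≠ 0 := by
    intro h
    apply hσ
    have := congrArg (fun x : 𝓞 L => (x : L)) (sub_eq_zero.mp h)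
    exact this
  let D : ℕ := Ideal.absNorm (Ideal.span {τ α - α})
  have hD : D ≠ 0 := by
    rw [Ne, Ideal.absNorm_eq_zero_iff]
    simpa using hτ
  refine no_double_cover F L (Δ * m.natAbs * D)
    (mul_ne_zero (mul_ne_zero hΔ (Int.natAbs_ne_zero.mpr hm)) hD) ?_
  intro P hP hp hpΔ
  have hpP : ((Ideal.absNorm P : ℕ) : 𝓞 F) ∈ P := Ideal.absNorm_mem P
  set p := Ideal.absNorm P with hpdef
  obtain ⟨φ, hφ⟩ := cong_int P p hpdef.symm hp
  have hpD : ¬ p ∣ D := fun h => hpΔ (h.mul_left _)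
  have hpm : ¬ p ∣ m.natAbs := fun h => hpΔ ((h.mul_left _).mul_right _)
  have hpΔ' : ¬ p ∣ Δ := fun h => hpΔ ((h.mul_right _).mul_right _)
  have : Fact p.Prime := ⟨hp⟩
  obtain ⟨a, ha⟩ := hcon p hp hpΔ' φ
  have hPprime : P.IsPrime := Ideal.isPrime_of_prime hP
  -- elements of 𝓞 F are congruent to integers
  have hF : ∀ x : 𝓞 F, ∃ n : ℤ, x - n ∈ P := by
    intro x
    refine ⟨((φ x).val : ℤ), ?_⟩
    rw [← hφ, RingHom.mem_ker]
    simp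
  have claim : ∀ Q : Ideal (𝓞 L), Q.IsPrime → Q.comap (algebraMap (𝓞 F) (𝓞 L)) = P →
      Prime Q ∧ Ideal.absNorm Q = p ∧ ∃ n : ℤ, α - n ∈ Q := by
    intro Q hQ hQP
    have hmemQ : ∀ x ∈ P, algebraMap (𝓞 F) (𝓞 L) x ∈ Q := by
      intro x hx
      rw [← hQP] at hx
      exact hx
    have hpQ : (p : 𝓞 L) ∈ Q := by
      have := hmemQ _ hpP
      rwa [map_natCast] at this
    have hFQ : ∀ x : 𝓞 F, ∃ n : ℤ, algebraMap (𝓞 F) (𝓞 L) x - n ∈ Q := by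
      intro x
      obtain ⟨n, hn⟩ := hF x
      refine ⟨n, ?_⟩
      have := hmemQ _ hn
      rwa [map_sub, map_intCast] at this
    have hαn : ∃ n : ℤ, α - n ∈ Q := by
      have h1 : (u : 𝓞 F) - ((a.val : ℕ) : 𝓞 F) ^ q ∈ P := by
        rw [← hφ, RingHom.mem_ker]
        simp [ha]
      have h2 := hmemQ _ h1
      rw [map_sub, map_pow, map_intCast, map_natCast, ← hα] at h2
      have hζL : IsPrimitiveRoot (algebraMap (𝓞 F) (𝓞 L) ζ) q :=
        hζ.map_of_injective (FaithfulSMul.algebraMap_injective _ _)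
      rw [hζL.pow_sub_pow_eq_prod_sub_mul _ _ hq] at h2
      obtain ⟨ξ, hξ, hξQ⟩ := (Ideal.IsPrime.prod_mem_iff).mp h2
      rw [Polynomial.mem_nthRootsFinset hq] at hξ
      have : NeZero q := ⟨hq.ne'⟩
      obtain ⟨i, -, rfl⟩ := hζL.eq_pow_of_pow_eq_one hξ
      obtain ⟨n, hn⟩ := hFQ (ζ ^ i * (a.val : ℕ))
      refine ⟨n, ?_⟩
      rw [map_mul, map_pow, map_natCast] at hn
      have := add_mem hξQ hn
      rwa [sub_add_sub_cancel] at this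
    have hA : ∀ x ∈ Algebra.adjoin (𝓞 F) {α}, ∃ n : ℤ, x - n ∈ Q := by
      intro x hx
      induction hx using Algebra.adjoin_induction with
      | mem x hx =>
        rw [Set.mem_singleton_iff] at hx
        rw [hx]; exact hαn
      | algebraMap r => exact hFQ r
      | add x y _ _ hx hy =>
        obtain ⟨n, hn⟩ := hx
        obtain ⟨k, hk⟩ := hy
        refine ⟨n + k, ?_⟩
        have := add_mem hn hk
        push_cast
        convert this using 1
        ring
      | mul x y _ _ hx hy =>
        obtain ⟨n, hn⟩ := hx
        obtain ⟨k, hk⟩ := hy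
        refine ⟨n * k, ?_⟩
        have := add_mem (Q.mul_mem_right y hn) (Q.mul_mem_left (n : 𝓞 L) hk)
        push_cast
        convert this using 1
        ring
    have hall : ∀ β : 𝓞 L, ∃ n : ℤ, β - n ∈ Q := by
      intro β
      obtain ⟨k, hk⟩ := hA _ (hmA β)
      have hcop : IsCoprime m (p : ℤ) := by
        rw [Int.isCoprime_iff_nat_coprime]
        simpa using ((Nat.Prime.coprime_iff_not_dvd hp).mpr hpm).symm
      obtain ⟨r, t, hrt⟩ := hcop
      refine ⟨r * k, ?_⟩
      have h1 : (r : 𝓞 L) * m + t * p = 1 := by exact_mod_cast congrArg (Int.cast (R := 𝓞 L)) hrt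
      have := add_mem (Q.mul_mem_left (r : 𝓞 L) hk) (Q.mul_mem_left ((t : 𝓞 L) * β) hpQ)
      convert this using 1
      push_cast
      linear_combination (-β) * h1
    have hnorm := norm_of_cong Q p hp hpQ hall
    refine ⟨?_, hnorm, hαn⟩
    refine Ideal.prime_of_isPrime ?_ hQ
    rintro rfl
    rw [Ideal.absNorm_bot] at hnorm
    exact hp.ne_zero hnorm.symm
  obtain ⟨Q, -, hQ, hQP⟩ := Ideal.exists_ideal_over_prime_of_isIntegral (S := 𝓞 L) P ⊥ (by
    intro x hx
    rw [Ideal.mem_comap, Ideal.mem_bot] at hx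
    have hx0 : x = 0 := (map_eq_zero_iff _ (FaithfulSMul.algebraMap_injective (𝓞 F) (𝓞 L))).mp hx
    rw [hx0]
    exact P.zero_mem)
  let Q' : Ideal (𝓞 L) := Q.comap (τ : 𝓞 L →+* 𝓞 L)
  have hQ' : Q'.IsPrime := hQ.comap _
  have hQ'P : Q'.comap (algebraMap (𝓞 F) (𝓞 L)) = P := by
    rw [← hQP]
    ext x
    simp [Q', Ideal.mem_comap]
  obtain ⟨h1, h2, n, hn⟩ := claim Q hQ hQP
  obtain ⟨h1', h2', -⟩ := claim Q' hQ' hQ'P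
  refine ⟨Q, Q', ?_, h1, h1', hQP, hQ'P, h2, h2'⟩
  intro hQQ
  have hn' := hn
  rw [hQQ] at hn'
  simp only [Q', Ideal.mem_comap, map_sub, map_intCast] at hn'
  have h3 : τ α - α ∈ Q := by
    have := sub_mem hn' hn
    convert this using 1
    simp
  apply hpD
  have := Ideal.absNorm_dvd_absNorm_of_le ((Ideal.span_singleton_le_iff_mem Q).mpr h3)
  rwa [h2] at this
end Algebraic

section Kummer
open NumberField

lemma root_pow_eq {M : Type*} [Field M] {q : ℕ} {ζ : M} (hζ : IsPrimitiveRoot ζ q) (hq : 0 < q)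
    (a b : ℕ) : ζ ^ a = ζ ^ b ↔ (a : ZMod q) = b := by
  rw [ZMod.natCast_eq_natCast_iff]
  have h1 : ∀ m : ℕ, ζ ^ m = ζ ^ (m % q) := by
    intro m
    conv_lhs => rw [← Nat.div_add_mod m q, pow_add, pow_mul, hζ.pow_eq_one, one_pow, one_mul]
  constructor
  · intro h
    rw [h1 a, h1 b] at h
    exact hζ.pow_inj (Nat.mod_lt _ hq) (Nat.mod_lt _ hq) h
  · intro h
    have h2 : a % q = b % q := h
    rw [h1 a, h1 b, h2]

/-- no non-trivial product of prime powers becomes a `q`-th power in the cyclotomic field -/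
lemma no_cyclo_root {M : Type*} [Field M] [NumberField M] {q n : ℕ} (hq : q.Prime)
    (p : Fin n → ℕ) (hp : ∀ i, (p i).Prime) (hpinj : Function.Injective p)
    (ζ : M) (hζ : IsPrimitiveRoot ζ q) (v : Fin n → ℕ)
    (w : IntermediateField.adjoin ℚ {ζ}) 
    (hw : w ^ q = ((∏ i, p i ^ v i : ℕ) : IntermediateField.adjoin ℚ {ζ})) (j : Fin n) :
    q ∣ v j := by
  set K := IntermediateField.adjoin ℚ {ζ}
  set T : ℕ := ∏ i, p i ^ v i with hT
  have hζi : IsIntegral ℚ ζ := Algebra.IsIntegral.isIntegral ζ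
  have hd : Module.finrank ℚ K < q := by
    rw [IntermediateField.adjoin.finrank hζi]
    have h1 : minpoly ℚ ζ ∣ Polynomial.cyclotomic q ℚ := by
      apply minpoly.dvd
      have := hζ.isRoot_cyclotomic hq.pos
      rwa [← Polynomial.map_cyclotomic q (algebraMap ℚ M), Polynomial.IsRoot,
        Polynomial.eval_map_algebraMap] at this
    have h2 := Polynomial.natDegree_le_of_dvd h1 (Polynomial.cyclotomic_ne_zero q ℚ)
    rw [Polynomial.natDegree_cyclotomic, Nat.totient_prime hq] at h2
    have := hq.pos
    omega
  have hd0 : 0 < Module.finrank ℚ K := Module.finrank_pos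
  have hN := congrArg (Algebra.norm ℚ) hw
  rw [map_pow, ← map_natCast (algebraMap ℚ K), Algebra.norm_algebraMap] at hN
  have hT0 : T ≠ 0 := Finset.prod_ne_zero_iff.mpr fun i _ => pow_ne_zero _ (hp i).ne_zero
  have hTQ : (T : ℚ) ≠ 0 := by exact_mod_cast hT0
  have : Fact (p j).Prime := ⟨hp j⟩
  have hv := congrArg (padicValRat (p j)) hN
  rw [padicValRat.pow, padicValRat.pow, padicValRat.of_nat] at hv
  have hTj : padicValNat (p j) T = v j := by
    rw [← Nat.factorization_def _ (hp j), hT, Nat.factorization_prod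
      (fun i _ => pow_ne_zero _ (hp i).ne_zero), Finsupp.finsetSum_apply, Finset.sum_eq_single j]
    · simp [Nat.Prime.factorization_pow (hp j)]
    · intro i _ hij
      rw [Nat.Prime.factorization_pow (hp i), Finsupp.single_eq_of_ne]
      exact fun h => hij (hpinj h.symm)
    · simp
  rw [hTj] at hv
  have h3 : q ∣ Module.finrank ℚ K * v j := by
    have : (q : ℤ) ∣ (Module.finrank ℚ K * v j : ℕ) := ⟨_, by push_cast; exact hv.symm⟩
    exact_mod_cast this
  rcases hq.dvd_mul.mp h3 with h | h
  · exact absurd (Nat.le_of_dvd hd0 h) (not_le.mpr hd)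
  · exact h

lemma kummer_surj {M : Type*} [Field M] [NumberField M] [IsGalois ℚ M] {q n : ℕ} (hq : q.Prime)
    (p : Fin n → ℕ) (hp : ∀ i, (p i).Prime) (hpinj : Function.Injective p)
    (ζ : M) (hζ : IsPrimitiveRoot ζ q) (α : Fin n → M) (hα : ∀ i, α i ^ q = (p i : M))
    (c : Fin n → ZMod q) :
    ∃ σ : M ≃ₐ[ℚ] M, σ ζ = ζ ∧ ∀ i, σ (α i) = ζ ^ (c i).val * α i := by
  classical
  have : Fact q.Prime := ⟨hq⟩
  set K := IntermediateField.adjoin ℚ {ζ} with hK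
  have hα0 : ∀ i, α i ≠ 0 := by
    intro i h
    have := hα i
    rw [h, zero_pow hq.ne_zero] at this
    exact (hp i).ne_zero (by exact_mod_cast this.symm)
  let ζK : K := ⟨ζ, IntermediateField.mem_adjoin_simple_self ℚ ζ⟩
  have hfix : ∀ σ : M ≃ₐ[K] M, σ ζ = ζ := fun σ => σ.commutes ζK
  have hex : ∀ σ : M ≃ₐ[K] M, ∀ i, ∃ e : ZMod q, σ (α i) = ζ ^ e.val * α i := by
    intro σ i
    have h1 : (σ (α i) / α i) ^ q = 1 := by
      rw [div_pow, ← map_pow, hα, map_natCast, div_self]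
      exact_mod_cast (hp i).ne_zero
    obtain ⟨m, hm, h2⟩ := hζ.eq_pow_of_pow_eq_one h1
    refine ⟨m, ?_⟩
    rw [ZMod.val_natCast, Nat.mod_eq_of_lt hm, h2, div_mul_cancel₀ _ (hα0 i)]
  choose e he using hex
  have huniq : ∀ σ i (m : ℕ), σ (α i) = ζ ^ m * α i → e σ i = m := by
    intro σ i m h
    rw [he σ i] at h
    have := mul_right_cancel₀ (hα0 i) h
    rw [root_pow_eq hζ hq.pos] at this
    simpa using this
  have hone : e 1 = 0 := by
    funext i
    rw [huniq 1 i 0 (by simp)]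
    simp
  have hmul : ∀ σ τ, e (σ * τ) = e σ + e τ := by
    intro σ τ
    funext i
    rw [huniq (σ * τ) i ((e σ i).val + (e τ i).val)]
    · simp
    · rw [AlgEquiv.mul_apply, he τ i, map_mul, map_pow, hfix, he σ i, pow_add]
      ring
  have hpow : ∀ σ (m : ℕ), e (σ ^ m) = m • e σ := by
    intro σ m
    induction m with
    | zero => simp [hone]
    | succ m ih => rw [pow_succ, hmul, ih, succ_nsmul]
  set W : Submodule (ZMod q) (Fin n → ZMod q) := Submodule.span _ (Set.range e) with hW
  have hWtop : W = ⊤ := by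
    by_contra hne
    obtain ⟨f, hf0, hf⟩ := Submodule.exists_le_ker_of_lt_top W (lt_top_iff_ne_top.mpr hne)
    let v : Fin n → ZMod q := fun i => f (Pi.single i 1)
    have hfv : ∀ x, f x = ∑ i, x i * v i := by
      intro x
      rw [LinearMap.pi_apply_eq_sum_univ f x]
      refine Finset.sum_congr rfl fun i _ => ?_
      rw [smul_eq_mul]
      congr 2
      funext j
      simp [Pi.single_apply, eq_comm]
    let γ : M := ∏ i, α i ^ (v i).val
    have hγ : ∀ σ : M ≃ₐ[K] M, σ γ = γ := by
      intro σ
      have h0 : f (e σ) = 0 := hf (Submodule.subset_span ⟨σ, rfl⟩)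
      rw [hfv] at h0
      have h1 : σ γ = ζ ^ (∑ i, (e σ i).val * (v i).val) * γ := by
        simp only [γ]
        rw [map_prod, ← Finset.prod_pow_eq_pow_sum, ← Finset.prod_mul_distrib]
        refine Finset.prod_congr rfl fun i _ => ?_
        rw [map_pow, he, mul_pow, pow_mul]
      have h2 : ζ ^ (∑ i, (e σ i).val * (v i).val) = ζ ^ 0 := by
        rw [root_pow_eq hζ hq.pos]
        push_cast
        simpa using h0
      rw [h1, h2, pow_zero, one_mul]
    have hγK : γ ∈ (⊥ : IntermediateField K M) := (IsGalois.mem_bot_iff_fixed γ).mpr hγ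
    obtain ⟨w, hw⟩ := IntermediateField.mem_bot.mp hγK
    have hwq : w ^ q = ((∏ i, p i ^ (v i).val : ℕ) : K) := by
      apply (algebraMap K M).injective
      rw [map_pow, hw, map_natCast]
      simp only [γ]
      rw [← Finset.prod_pow]
      push_cast
      refine Finset.prod_congr rfl fun i _ => ?_
      rw [← pow_mul, mul_comm, pow_mul, hα]
    have hv0 : ∀ i, v i = 0 := by
      intro i
      have h := no_cyclo_root hq p hp hpinj ζ hζ _ w hwq i
      have := Nat.eq_zero_of_dvd_of_lt h (ZMod.val_lt _)
      exact (ZMod.val_eq_zero _).mp this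
    apply hf0
    ext x
    simp [v] at hv0
    simp [hv0]
  have hall : ∀ x ∈ W, ∃ σ, e σ = x := by
    intro x hx
    induction hx using Submodule.span_induction with
    | mem x hx => exact hx
    | zero => exact ⟨1, hone⟩
    | add x y _ _ hx hy =>
      obtain ⟨σ, rfl⟩ := hx
      obtain ⟨τ, rfl⟩ := hy
      exact ⟨σ * τ, hmul σ τ⟩
    | smul a x _ hx =>
      obtain ⟨σ, rfl⟩ := hx
      refine ⟨σ ^ a.val, ?_⟩
      rw [hpow]
      funext i
      simp
  obtain ⟨σ, hσ⟩ := hall c (by rw [hWtop]; trivial)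
  refine ⟨σ.restrictScalars ℚ, hfix σ, fun i => ?_⟩
  rw [← hσ]
  exact he σ i

end Kummer

section ClaimA
open NumberField Polynomial

lemma exists_field (f : ℚ[X]) : ∃ (M : Type) (_ : Field M) (_ : NumberField M),
    IsGalois ℚ M ∧ IsSplittingField ℚ M f := by
  have h1 : @IsSplittingField ℚ f.SplittingField _ _ DivisionRing.toRatAlgebra f := by
    convert IsSplittingField.splittingField f
    exact Subsingleton.elim _ _
  have hc : CharZero f.SplittingField := by
    have := algebraRat.charZero f.SplittingField
    exact this
  have h2 : FiniteDimensional ℚ f.SplittingField := IsSplittingField.finiteDimensional _ f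
  have h3 : Normal ℚ f.SplittingField := Normal.of_isSplittingField f
  exact ⟨f.SplittingField, inferInstance, { }, { }, h1⟩

lemma exists_kummer_field {q n : ℕ} (hq : q.Prime) (p : Fin n → ℕ) (hp : ∀ i, (p i).Prime) :
    ∃ (M : Type) (_ : Field M) (_ : NumberField M), IsGalois ℚ M ∧
      ∃ (ζ : M) (α : Fin n → M), IsPrimitiveRoot ζ q ∧ (∀ i, α i ^ q = (p i : M)) ∧
        ∀ A : Subalgebra ℚ M, ζ ∈ A → (∀ i, α i ∈ A) → A = ⊤ := by
  classical
  have : NeZero q := ⟨hq.ne_zero⟩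
  let f : ℚ[X] := (X ^ q - C 1) * ∏ i, (X ^ q - C (p i : ℚ))
  have hf0 : f ≠ 0 := mul_ne_zero (X_pow_sub_C_ne_zero hq.pos _)
    (Finset.prod_ne_zero_iff.mpr fun i _ => X_pow_sub_C_ne_zero hq.pos _)
  obtain ⟨M, _, _, hG, hs⟩ := exists_field f
  have hsp : (f.map (algebraMap ℚ M)).Splits := IsSplittingField.splits M f
  have hfm0 : f.map (algebraMap ℚ M) ≠ 0 := (Polynomial.map_ne_zero_iff (algebraMap ℚ M).injective).mpr hf0
  have hdiv : ∀ g : ℚ[X], g ∣ f → (g.map (algebraMap ℚ M)).Splits := fun g hg =>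
    hsp.of_dvd hfm0 (Polynomial.map_dvd _ hg)
  have hdeg : ∀ a : ℚ, (map (algebraMap ℚ M) (X ^ q - C a)).degree ≠ 0 := by
    intro a
    rw [degree_map, degree_X_pow_sub_C hq.pos]
    exact_mod_cast hq.ne_zero
  have hα : ∀ i, ∃ a : M, a ^ q = (p i : M) := by
    intro i
    obtain ⟨a, ha⟩ := (hdiv (X ^ q - C (p i : ℚ))
      ((Finset.dvd_prod_of_mem _ (Finset.mem_univ i)).mul_left _)).exists_eval_eq_zero (hdeg _)
    refine ⟨a, ?_⟩
    simpa [sub_eq_zero] using ha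
  choose α hα using hα
  have hcyc : cyclotomic q ℚ ∣ f := by
    refine Dvd.dvd.mul_right ?_ _
    rw [map_one]
    exact cyclotomic.dvd_X_pow_sub_one q ℚ
  obtain ⟨ζ, hζ⟩ := (hdiv _ hcyc).exists_eval_eq_zero (by
    rw [degree_map]
    exact (degree_cyclotomic_pos q ℚ hq.pos).ne')
  rw [map_cyclotomic] at hζ
  have hζ : IsPrimitiveRoot ζ q := isRoot_cyclotomic_iff.mp hζ
  refine ⟨M, inferInstance, inferInstance, hG, ζ, α, hζ, hα, fun A hA hAα => ?_⟩
  rw [eq_top_iff, ← IsSplittingField.adjoin_rootSet M f, Algebra.adjoin_le_iff]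
  intro x hx
  have hx := (mem_rootSet.mp hx).2
  simp only [f, map_mul, map_prod, map_sub, map_pow, aeval_X, aeval_C, map_one] at hx
  have hroot : ∀ y : M, y ^ q = 1 → y ∈ A := by
    intro y hy
    obtain ⟨i, -, rfl⟩ := hζ.eq_pow_of_pow_eq_one hy
    exact pow_mem hA i
  rcases mul_eq_zero.mp hx with h | h
  · exact hroot x (sub_eq_zero.mp h)
  · obtain ⟨i, -, hi⟩ := Finset.prod_eq_zero_iff.mp h
    have hi := sub_eq_zero.mp hi
    rw [map_natCast] at hi
    have hpi : (p i : M) ≠ 0 := by exact_mod_cast (hp i).ne_zero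
    have hαi : α i ≠ 0 := by
      intro h0
      apply hpi
      rw [← hα, h0, zero_pow hq.ne_zero]
    have h1 := hroot (x / α i) (by rw [div_pow, hi, hα, div_self hpi])
    have := mul_mem h1 (hAα i)
    rwa [div_mul_cancel₀ _ hαi] at this

set_option maxHeartbeats 1000000 in
theorem claimA {q n : ℕ} (hq : q.Prime) (p : Fin n → ℕ) (hp : ∀ i, (p i).Prime)
    (hpinj : Function.Injective p) (c : Fin n → ZMod q) (hc : c ≠ 0) (Δ : ℕ) (hΔ : Δ ≠ 0) :
    ∃ P : ℕ, P.Prime ∧ ¬ P ∣ Δ ∧ ∀ ν : Fin n → ℕ,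
      (∃ a : ZMod P, a ^ q = ∏ i, (p i : ZMod P) ^ ν i) → ∑ i, c i * (ν i : ZMod q) = 0 := by
  classical
  have : Fact q.Prime := ⟨hq⟩
  obtain ⟨M, _, _, hG, ζ, α, hζ, hα, htop⟩ := exists_kummer_field hq p hp
  obtain ⟨σ, hσζ, hσα⟩ := kummer_surj hq p hp hpinj ζ hζ α hα c
  obtain ⟨i0, hi0⟩ : ∃ i, c i ≠ 0 := Function.ne_iff.mp hc
  have hα0 : ∀ i, α i ≠ 0 := by
    intro i h
    have := hα i
    rw [h, zero_pow hq.ne_zero] at this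
    exact (hp i).ne_zero (by exact_mod_cast this.symm)
  obtain ⟨F, hF⟩ : ∃ F : IntermediateField ℚ M, ∀ x : M, x ∈ F ↔ σ x = x := by
    refine ⟨IntermediateField.fixedField (Subgroup.zpowers σ), fun x => ?_⟩
    rw [IntermediateField.mem_fixedField_iff]
    constructor
    · intro h
      exact h σ (Subgroup.mem_zpowers σ)
    · intro h g hg
      have : Subgroup.zpowers σ ≤ MulAction.stabilizer (M ≃ₐ[ℚ] M) x := by
        rw [Subgroup.zpowers_le]
        exact h
      exact this hg
  let σF : M ≃ₐ[F] M := AlgEquiv.ofRingEquiv (f := (σ : M ≃+* M)) (fun x => (hF x).mp x.2)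
  have hζF : ζ ∈ F := (hF ζ).mpr hσζ
  have hζint : IsIntegral ℤ (⟨ζ, hζF⟩ : F) := by
    refine IsIntegral.of_pow hq.pos ?_
    have : (⟨ζ, hζF⟩ : F) ^ q = 1 := Subtype.ext hζ.pow_eq_one
    rw [this]
    exact isIntegral_one
  let ζF : 𝓞 F := ⟨⟨ζ, hζF⟩, hζint⟩
  have hζF' : IsPrimitiveRoot ζF q := by
    have hinj : Function.Injective ((algebraMap F M).comp (algebraMap (𝓞 F) F)) :=
      (algebraMap F M).injective.comp RingOfIntegers.coe_injective
    exact IsPrimitiveRoot.of_map_of_injective (f := (algebraMap F M).comp (algebraMap (𝓞 F) F))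
      hζ hinj
  have hαint : ∀ i, IsIntegral ℤ (α i) := by
    intro i
    refine IsIntegral.of_pow hq.pos ?_
    rw [hα]
    simpa using isIntegral_algebraMap (R := ℤ) (A := M) (x := (p i : ℤ))
  let αO : 𝓞 M := ⟨α i0, hαint i0⟩
  have hαO : αO ^ q = ((p i0 : ℤ) : 𝓞 M) := by
    apply RingOfIntegers.coe_injective
    rw [map_pow]
    change α i0 ^ q = _
    rw [hα]
    simp
  have hpow1 : ∀ m : ℕ, ζ ^ m = 1 ↔ (m : ZMod q) = 0 := by
    intro m
    have := root_pow_eq hζ hq.pos m 0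
    simpa using this
  have hadj : Algebra.adjoin F {(αO : M)} = ⊤ := by
    have hcoe : (αO : M) = α i0 := rfl
    rw [hcoe]
    have h1 := htop ((Algebra.adjoin F {α i0}).restrictScalars ℚ)
      (Subalgebra.algebraMap_mem (Algebra.adjoin F {α i0}) (⟨ζ, hζF⟩ : F)) ?_
    · rw [eq_top_iff]
      intro x _
      have : x ∈ (Algebra.adjoin F {α i0}).restrictScalars ℚ := by rw [h1]; trivial
      exact this
    · intro i
      let t : ℕ := (c i / c i0).val
      have hmem : α i / α i0 ^ t ∈ F := by
        rw [hF, map_div₀, map_pow, hσα, hσα, mul_pow, ← pow_mul]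
        have : ζ ^ ((c i0).val * t) = ζ ^ (c i).val := by
          rw [root_pow_eq hζ hq.pos]
          simp [t]
          field_simp
        rw [this, mul_div_mul_left _ _ (pow_ne_zero _ (hζ.ne_zero hq.ne_zero))]
      obtain ⟨y, hy⟩ : ∃ y : F, algebraMap F M y = α i / α i0 ^ t := ⟨⟨_, hmem⟩, rfl⟩
      have h2 : α i = algebraMap F M y * α i0 ^ t := by
        rw [hy, div_mul_cancel₀ _ (pow_ne_zero _ (hα0 i0))]
      have h3 : algebraMap F M y * α i0 ^ t ∈ Algebra.adjoin F {α i0} :=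
        mul_mem (Subalgebra.algebraMap_mem _ _) (pow_mem (Algebra.self_mem_adjoin_singleton F _) _)
      rw [← h2] at h3
      exact h3
  have hσ1 : σF (αO : M) ≠ αO := by
    intro h
    have h1 : σ (α i0) = α i0 := h
    rw [hσα] at h1
    have h2 : ζ ^ (c i0).val = 1 := by
      apply mul_right_cancel₀ (hα0 i0)
      rw [h1, one_mul]
    rw [hpow1] at h2
    apply hi0
    simpa using h2
  obtain ⟨P, hP, hPΔ, φ, hφ⟩ := exists_nonsplit F M σF q hq.pos ζF hζF' (p i0 : ℤ) αO hαO hadj hσ1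
    (Δ * ∏ i, p i) (mul_ne_zero hΔ (Finset.prod_ne_zero_iff.mpr fun i _ => (hp i).ne_zero))
  have : Fact P.Prime := ⟨hP⟩
  refine ⟨P, hP, fun h => hPΔ (h.mul_right _), ?_⟩
  rintro ν ⟨a, ha⟩
  by_contra hs
  apply hφ
  set s := ∑ i, c i * (ν i : ZMod q) with hsdef
  let t : ℕ := (- c i0 / s).val
  have ht : (t : ZMod q) * s = - c i0 := by
    simp only [t, ZMod.natCast_val, ZMod.cast_id', id]
    field_simp
  let β : M := (∏ i, α i ^ (ν i)) ^ t * α i0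
  have hβ : β ∈ F := by
    rw [hF]
    simp only [β]
    have h1 : σ (∏ i, α i ^ (ν i)) = ζ ^ (∑ i, (c i).val * ν i) * ∏ i, α i ^ (ν i) := by
      rw [map_prod, ← Finset.prod_pow_eq_pow_sum, ← Finset.prod_mul_distrib]
      refine Finset.prod_congr rfl fun i _ => ?_
      rw [map_pow, hσα, mul_pow, pow_mul]
    rw [map_mul, map_pow, h1, hσα, mul_pow, ← pow_mul]
    have h2 : ζ ^ ((∑ i, (c i).val * ν i) * t + (c i0).val) = 1 := by
      rw [hpow1]
      push_cast
      simp only [ZMod.natCast_val, ZMod.cast_id', id]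
      rw [← hsdef, mul_comm, ht]
      ring
    rw [pow_add] at h2
    linear_combination ((∏ i, α i ^ (ν i)) ^ t * α i0) * h2
  have hβint : IsIntegral ℤ β :=
    ((IsIntegral.prod _ fun i _ => (hαint i).pow _).pow _).mul (hαint i0)
  let βO : 𝓞 F := ⟨⟨β, hβ⟩, (isIntegral_algebraMap_iff (algebraMap F M).injective).mp hβint⟩
  have hβq : βO ^ q = (((∏ i, p i ^ ν i) ^ t * p i0 : ℕ) : 𝓞 F) := by
    have hinj : Function.Injective ((algebraMap F M).comp (algebraMap (𝓞 F) F)) :=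
      (algebraMap F M).injective.comp RingOfIntegers.coe_injective
    apply hinj
    rw [map_pow, map_natCast]
    change β ^ q = _
    simp only [β]
    push_cast
    rw [mul_pow, hα, ← pow_mul, mul_comm t q, pow_mul, ← Finset.prod_pow]
    congr 2
    refine Finset.prod_congr rfl fun i _ => ?_
    rw [← pow_mul, mul_comm, pow_mul, hα]
  have h3 := congrArg φ hβq
  rw [map_pow, map_natCast] at h3
  push_cast at h3
  rw [← ha] at h3
  have ha0 : a ≠ 0 := by
    rintro rfl
    rw [zero_pow hq.ne_zero] at ha
    obtain ⟨i, -, hi⟩ := Finset.prod_eq_zero_iff.mp ha.symm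
    have hi := eq_zero_of_pow_eq_zero hi
    rw [ZMod.natCast_eq_zero_iff] at hi
    exact hPΔ ((hi.trans (Finset.dvd_prod_of_mem p (Finset.mem_univ i))).mul_left _)
  refine ⟨φ βO / a ^ t, ?_⟩
  rw [div_pow, h3]
  push_cast
  rw [← pow_mul, ← pow_mul, mul_comm t q]
  field_simp
end ClaimA

section Final

lemma exists_discrete_log {q n r : ℕ} (hr : r.Prime) (p : Fin n → ℕ)
    (hrp : ¬ r ∣ ∏ i, p i) : ∃ e : Fin n → ℕ, ∀ ν : Fin n → ℕ,
      ∑ i, (e i : ZMod q) * (ν i : ZMod q) = 0 →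
        ∃ a : ZMod r, a ^ q = ∏ i, (p i : ZMod r) ^ ν i := by
  have : Fact r.Prime := ⟨hr⟩
  obtain ⟨g, hg⟩ := IsCyclic.exists_monoid_generator (α := (ZMod r)ˣ)
  have h1 : ∀ i, ∃ e : ℕ, (g : ZMod r) ^ e = p i := by
    intro i
    have h0 : (p i : ZMod r) ≠ 0 := by
      rw [Ne, ZMod.natCast_eq_zero_iff]
      exact fun h => hrp (h.trans (Finset.dvd_prod_of_mem p (Finset.mem_univ i)))
    obtain ⟨e, he⟩ := hg (Units.mk0 _ h0)
    exact ⟨e, by simpa using congrArg (Units.val) he⟩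
  choose e he using h1
  refine ⟨e, fun ν h => ?_⟩
  have h2 : q ∣ ∑ i, e i * ν i := by
    rw [← ZMod.natCast_eq_zero_iff]
    push_cast
    exact h
  obtain ⟨m, hm⟩ := h2
  refine ⟨(g : ZMod r) ^ m, ?_⟩
  rw [← pow_mul, mul_comm, ← hm, ← Finset.prod_pow_eq_pow_sum]
  refine Finset.prod_congr rfl fun i _ => ?_
  rw [pow_mul, he]

lemma lift_prime_pow {q r : ℕ} (hq : q.Prime) (hr : r.Prime) (hrq : ¬ r ∣ q) (t x : ℤ)
    (hrt : ¬ (r : ℤ) ∣ t) (h : (r : ℤ) ∣ x ^ q - t) (m : ℕ) :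
    ∃ y : ℤ, (r : ℤ) ^ m ∣ y ^ q - t := by
  have h1 : (r : ℤ) ^ (m + 1) ∣ (x ^ q) ^ (r ^ m) - t ^ (r ^ m) := dvd_sub_pow_of_dvd_sub h m
  have h1 : (r : ℤ) ^ m ∣ (x ^ q) ^ (r ^ m) - t ^ (r ^ m) := (pow_dvd_pow _ (Nat.le_succ m)).trans h1
  have hcop : Nat.Coprime (r ^ m) q :=
    Nat.Coprime.pow_left m ((Nat.Prime.coprime_iff_not_dvd hr).mpr hrq)
  obtain ⟨v, hv⟩ := Nat.exists_mul_mod_eq_one_of_coprime hcop hq.one_lt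
  set u := r ^ m * v / q
  have hv' : r ^ m * v = q * u + 1 := by
    have := Nat.div_add_mod (r ^ m * v) q
    rw [hv.2] at this
    exact this.symm
  have hct : IsCoprime t ((r : ℤ) ^ m) := by
    apply IsCoprime.pow_right
    exact ((Nat.prime_iff_prime_int.mp hr).coprime_iff_not_dvd.mpr hrt).symm
  obtain ⟨t', s, hts⟩ := hct
  refine ⟨(x ^ (r ^ m)) ^ v * t' ^ u, ?_⟩
  have h2 : (r : ℤ) ^ m ∣ ((x ^ q) ^ (r ^ m)) ^ v - (t ^ (r ^ m)) ^ v :=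
    h1.trans (sub_dvd_pow_sub_pow _ _ v)
  have h3 : (r : ℤ) ^ m ∣ (t' * t) ^ (q * u) - 1 ^ (q * u) := by
    refine Dvd.dvd.trans ?_ (sub_dvd_pow_sub_pow _ _ (q * u))
    exact ⟨-s, by linear_combination hts⟩
  have h4 := dvd_add (h2.mul_right (t' ^ (u * q))) (h3.mul_right t)
  have e1 : (t ^ (r ^ m)) ^ v = t ^ (q * u) * t := by rw [← pow_mul, hv', pow_succ]
  have e2 : ((x ^ q) ^ (r ^ m)) ^ v = ((x ^ (r ^ m)) ^ v) ^ q := by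
    rw [← pow_mul, ← pow_mul, ← pow_mul, ← pow_mul]
    congr 1
    ring
  rw [e1, e2, mul_pow, one_pow, mul_comm u q] at h4
  rw [mul_pow, ← pow_mul t', mul_comm u q]
  have e3 : ((x ^ (r ^ m)) ^ v) ^ q * t' ^ (q * u) - t
      = (((x ^ (r ^ m)) ^ v) ^ q - t ^ (q * u) * t) * t' ^ (q * u)
        + (t' ^ (q * u) * t ^ (q * u) - 1) * t := by ring
  rw [e3]
  exact h4

lemma crt_pow (q : ℕ) (t : ℤ) (N : ℕ) : 0 < N →
    (∀ r : ℕ, r.Prime → r ∣ N → ∀ m : ℕ, ∃ x : ℤ, (r : ℤ) ^ m ∣ x ^ q - t) →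
    ∃ x : ℤ, (N : ℤ) ∣ x ^ q - t := by
  induction N using Nat.recOnPosPrimePosCoprime with
  | prime_pow r m hr hm =>
    intro _ h
    obtain ⟨x, hx⟩ := h r hr (dvd_pow_self r hm.ne') m
    exact ⟨x, by exact_mod_cast hx⟩
  | zero => intro h; exact absurd h (lt_irrefl 0)
  | one => intro _ _; exact ⟨0, by simp⟩
  | coprime a b ha hb hab iha ihb =>
    intro _ h
    obtain ⟨x, hx⟩ := iha (by omega) fun r hr hra => h r hr (hra.mul_right _)
    obtain ⟨y, hy⟩ := ihb (by omega) fun r hr hrb => h r hr (hrb.mul_left _)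
    have hc : IsCoprime (a : ℤ) (b : ℤ) := Nat.isCoprime_iff_coprime.mpr hab
    obtain ⟨u, v, huv⟩ := hc
    refine ⟨x * (v * b) + y * (u * a), ?_⟩
    push_cast
    refine IsCoprime.mul_dvd ⟨u, v, huv⟩ ?_ ?_
    · have h1 : (a : ℤ) ∣ (x * (v * b) + y * (u * a)) - x :=
        ⟨u * (y - x), by linear_combination x * huv⟩
      have := dvd_add (h1.trans (sub_dvd_pow_sub_pow _ _ q)) hx
      rwa [sub_add_sub_cancel] at this
    · have h1 : (b : ℤ) ∣ (x * (v * b) + y * (u * a)) - y :=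
        ⟨v * (x - y), by linear_combination y * huv⟩
      have := dvd_add (h1.trans (sub_dvd_pow_sub_pow _ _ q)) hy
      rwa [sub_add_sub_cancel] at this

lemma per_prime {q n : ℕ} (hq : q.Prime) (p : Fin n → ℕ) (hp : ∀ i, (p i).Prime)
    (hpinj : Function.Injective p) (b : Fin n → ℕ) (Δ : ℕ) (hΔ : Δ ≠ 0) (r : ℕ) (hr : r.Prime)
    (hrΔ : ¬ r ∣ q * ∏ i, p i) :
    ∃ P : ℕ, 0 < P ∧ P.primeFactorsList.length ≤ 1 ∧ Nat.Coprime P Δ ∧ ∀ ν : Fin n → ℕ,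
      (∃ x : ℤ, (P : ℤ) ∣ x ^ q - ∏ i, (p i : ℤ) ^ ν i) →
        ∀ m : ℕ, ∃ x : ℤ, (r : ℤ) ^ m ∣ x ^ q - ∏ i, (p i : ℤ) ^ (b i * ν i) := by
  have : Fact r.Prime := ⟨hr⟩
  have hrq : ¬ r ∣ q := fun h => hrΔ (h.mul_right _)
  have hrp : ¬ r ∣ ∏ i, p i := fun h => hrΔ (h.mul_left _)
  obtain ⟨e, he⟩ := exists_discrete_log (q := q) hr p hrp
  let c : Fin n → ZMod q := fun i => (e i : ZMod q) * b i
  have key : ∀ ν : Fin n → ℕ, ∑ i, c i * (ν i : ZMod q) = 0 →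
      ∀ m : ℕ, ∃ x : ℤ, (r : ℤ) ^ m ∣ x ^ q - ∏ i, (p i : ℤ) ^ (b i * ν i) := by
    intro ν hν
    obtain ⟨a, ha⟩ := he (fun i => b i * ν i) (by
      rw [← hν]
      refine Finset.sum_congr rfl fun i _ => ?_
      simp only [c]
      push_cast
      ring)
    refine lift_prime_pow hq hr hrq _ (a.val : ℤ) ?_ ?_
    · intro h
      obtain ⟨i, -, hi⟩ := (Nat.prime_iff_prime_int.mp hr).exists_mem_finset_dvd h
      have hi := (Nat.prime_iff_prime_int.mp hr).dvd_of_dvd_pow hi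
      have hi : r ∣ p i := by exact_mod_cast hi
      exact hrp (hi.trans (Finset.dvd_prod_of_mem p (Finset.mem_univ i)))
    · rw [← ZMod.intCast_zmod_eq_zero_iff_dvd]
      push_cast
      rw [← ha]
      simp
  by_cases hc : c = 0
  · refine ⟨1, one_pos, by simp, by simp, fun ν _ => key ν ?_⟩
    simp [hc]
  · obtain ⟨P, hP, hPΔ, h⟩ := claimA hq p hp hpinj c hc Δ hΔ
    have : Fact P.Prime := ⟨hP⟩
    refine ⟨P, hP.pos, by simp [Nat.primeFactorsList_prime hP],
      (Nat.Prime.coprime_iff_not_dvd hP).mpr hPΔ, ?_⟩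
    rintro ν ⟨x, hx⟩
    refine key ν (h ν ⟨(x : ZMod P), ?_⟩)
    rw [← ZMod.intCast_zmod_eq_zero_iff_dvd] at hx
    push_cast at hx
    exact sub_eq_zero.mp hx

lemma length_prod_le (s : Finset ℕ) (P : ℕ → ℕ) (h0 : ∀ r ∈ s, 0 < P r)
    (h : ∀ r ∈ s, (P r).primeFactorsList.length ≤ 1) :
    (∏ r ∈ s, P r).primeFactorsList.length ≤ s.card := by
  classical
  induction s using Finset.induction_on with
  | empty => simp
  | insert a s ha ih =>
    rw [Finset.prod_insert ha, Finset.card_insert_of_notMem ha]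
    have h1 := ih (fun r hr => h0 r (Finset.mem_insert_of_mem hr))
      (fun r hr => h r (Finset.mem_insert_of_mem hr))
    have h2 := h a (Finset.mem_insert_self a s)
    have h3 := (Nat.perm_primeFactorsList_mul (h0 a (Finset.mem_insert_self a s)).ne'
      (Finset.prod_ne_zero_iff.mpr fun r hr =>
        (h0 r (Finset.mem_insert_of_mem hr)).ne')).length_eq
    rw [h3, List.length_append]
    omega

end Final

/-- **Corollary (powers of primes in the factorization).** If
`S = {∏ p_i^{ν_{ij}}} ∈ 𝒯_{k,q}` then `{∏ p_i^{b_i ν_{ij}}} ∈ 𝒯_{k,q}` for all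
`b_1, …, b_n ∈ {1, …, q-1}`. -/
theorem stmt6 (q k n ℓ : ℕ) (hq : q.Prime) (hodd : Odd q) (hk : 1 ≤ k)
    (p : Fin n → ℕ) (hp : ∀ i, (p i).Prime) (hpinj : Function.Injective p)
    (ν : Fin ℓ → Fin n → ℕ)
    (hpow : ∀ j : Fin ℓ, ¬ IsPerfectPow q (∏ i, (p i : ℤ) ^ ν j i))
    (hS : MemT q k ↑(Finset.image (fun j : Fin ℓ => ∏ i, (p i : ℤ) ^ ν j i) Finset.univ))
    (b : Fin n → ℕ) (hb : ∀ i, 1 ≤ b i ∧ b i ≤ q - 1) :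
    MemT q k
      ↑(Finset.image (fun j : Fin ℓ => ∏ i, (p i : ℤ) ^ (b i * ν j i)) Finset.univ) := by
  classical
  obtain ⟨Δ, hΔ, hS⟩ := hS
  have hΔ'0 : q * ∏ i, p i ≠ 0 := mul_ne_zero hq.ne_zero
    (Finset.prod_ne_zero_iff.mpr fun i _ => (hp i).ne_zero)
  refine ⟨q * ∏ i, p i, Nat.pos_of_ne_zero hΔ'0, fun N hN hNk hNΔ => ?_⟩
  have hex : ∀ r : ℕ, ∃ P : ℕ, r ∈ N.primeFactors → 0 < P ∧ P.primeFactorsList.length ≤ 1 ∧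
      Nat.Coprime P Δ ∧ ∀ ν : Fin n → ℕ,
      (∃ x : ℤ, (P : ℤ) ∣ x ^ q - ∏ i, (p i : ℤ) ^ ν i) →
        ∀ m : ℕ, ∃ x : ℤ, (r : ℤ) ^ m ∣ x ^ q - ∏ i, (p i : ℤ) ^ (b i * ν i) := by
    intro r
    by_cases hr : r ∈ N.primeFactors
    · have hrp := Nat.prime_of_mem_primeFactors hr
      have hrN := Nat.dvd_of_mem_primeFactors hr
      obtain ⟨P, hP⟩ := per_prime hq p hp hpinj b Δ hΔ.ne' r hrp (fun h =>
        hrp.one_lt.ne' (Nat.eq_one_of_dvd_coprimes hNΔ hrN h))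
      exact ⟨P, fun _ => hP⟩
    · exact ⟨0, fun h => absurd h hr⟩
  choose P hP using hex
  obtain ⟨s, hs, x, hx⟩ := hS (∏ r ∈ N.primeFactors, P r)
    (Finset.prod_pos fun r hr => (hP r hr).1)
    ((length_prod_le _ P (fun r hr => (hP r hr).1) (fun r hr => (hP r hr).2.1)).trans
      ((List.toFinset_card_le _).trans hNk))
    (Nat.Coprime.prod_left fun r hr => (hP r hr).2.2.1)
  rw [Finset.mem_coe, Finset.mem_image] at hs
  obtain ⟨j, -, rfl⟩ := hs
  refine ⟨∏ i, (p i : ℤ) ^ (b i * ν j i), ?_, ?_⟩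
  · rw [Finset.mem_coe, Finset.mem_image]
    exact ⟨j, Finset.mem_univ _, rfl⟩
  · refine crt_pow q _ N hN fun r hr hrN => ?_
    have hmem : r ∈ N.primeFactors := Nat.mem_primeFactors.mpr ⟨hr, hrN, hN.ne'⟩
    refine (hP r hmem).2.2.2 (ν j) ⟨x, ?_⟩
    refine Dvd.dvd.trans ?_ hx
    exact_mod_cast Finset.dvd_prod_of_mem P hmem
end

section
/- Let q be a prime and n > k ≥ 1. Every k-blocking set B of PG(F_q^n) satisfies |B| ≥ (q^{k+1} − 1)/(q − 1). Moreover, if |B| = (q^{k+1} − 1)/(q − 1), then B is a k-space of PG(F_q^n), i.e., B = {⟨w⟩ : w ∈ W, w ≠ 0} for some (k+1)-dimensional F_q-linear subspace W of F_q^n. -/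
open Finset

/-- `S` is the set of nonzero vectors representing a `k`-blocking set in a space of dimension `n`. -/
def ConeBlocking (F : Type) [Field F] {V : Type} [AddCommGroup V] [Module F V]
    (n k : ℕ) (S : Set V) : Prop :=
  Module.finrank F V = n ∧ k < n ∧ (0 : V) ∉ S ∧
    (∀ (c : F) (v : V), c ≠ 0 → v ∈ S → c • v ∈ S) ∧
    (∀ W : Submodule F V, Module.finrank F W = n - k → ∃ v ∈ W, v ∈ S)

/-- Projection from a point off the blocking set. -/
theorem bb_proj {F : Type} [Field F] {V : Type} [AddCommGroup V] [Module F V]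
    [Finite V] (n k : ℕ) (S : Set V) (h : ConeBlocking F (n + 1) k S) (p : V) (hp0 : p ≠ 0)
    (hpS : p ∉ S) :
    ConeBlocking F n k ((Submodule.span F {p}).mkQ '' S) := by
  obtain ⟨hn, hkn, h0, hS, hB⟩ := h
  have hP1 : Module.finrank F (Submodule.span F {p}) = 1 := finrank_span_singleton hp0
  have hdisj : ∀ v ∈ Submodule.span F {p}, v ∉ S := by
    intro v hv hvS
    obtain ⟨c, rfl⟩ := Submodule.mem_span_singleton.1 hv
    by_cases hc : c = 0
    · subst hc; simp at hvS; exact h0 hvS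
    · apply hpS
      have := hS c⁻¹ _ (inv_ne_zero hc) hvS
      rwa [smul_smul, inv_mul_cancel₀ hc, one_smul] at this
  have hkn' : k < n := by
    by_contra hlt
    obtain ⟨v, hv, hvS⟩ := hB (Submodule.span F {p}) (by rw [hP1]; omega)
    exact hdisj v hv hvS
  have hq := Submodule.finrank_quotient_add_finrank (Submodule.span F {p})
  set P := Submodule.span F {p} with hP
  refine ⟨by omega, hkn', ?_, ?_, ?_⟩
  · rintro ⟨v, hv, hv0⟩
    exact hdisj v ((Submodule.Quotient.mk_eq_zero P).1 hv0) hv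
  · rintro c _ hc ⟨v, hv, rfl⟩
    exact ⟨c • v, hS c v hc hv, by simp⟩
  · intro W hW
    have h3 : Module.finrank F (W.comap P.mkQ) = n + 1 - k := by
      have h4 := LinearMap.finrank_range_add_finrank_ker (P.mkQ.comp (W.comap P.mkQ).subtype)
      have h5 : LinearMap.range (P.mkQ.comp (W.comap P.mkQ).subtype) = W := by
        rw [LinearMap.range_comp, Submodule.range_subtype,
          Submodule.map_comap_eq_of_surjective P.mkQ_surjective]
      have h6 : Module.finrank F
          (LinearMap.ker (P.mkQ.comp (W.comap P.mkQ).subtype)) = 1 := by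
        rw [LinearMap.ker_comp, Submodule.ker_mkQ, ← hP1]
        exact (Submodule.comapSubtypeEquivOfLe (Submodule.le_comap_mkQ P W)).finrank_eq
      rw [h5, h6] at h4
      omega
    obtain ⟨v, hv, hvS⟩ := hB _ h3
    exact ⟨P.mkQ v, hv, v, hvS, rfl⟩

/-- Cone form of the Bose–Burton bound. -/
theorem bb_bound {F : Type} [Field F] [Fintype F] (k : ℕ) : ∀ (n : ℕ) (V : Type) [AddCommGroup V]
    [Module F V] [Finite V] (S : Set V), ConeBlocking F n k S →
    Fintype.card F ^ (k + 1) ≤ S.ncard + 1 := by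
  intro n
  induction n with
  | zero => intro V _ _ _ S h; have := h.2.1; omega
  | succ n ih =>
    intro V _ _ _ S h
    by_cases hall : ∀ v : V, v ≠ 0 → v ∈ S
    · have hSe : S = {0}ᶜ := by
        ext v
        simp only [Set.mem_compl_iff, Set.mem_singleton_iff]
        exact ⟨fun h1 h' => h.2.2.1 (h' ▸ h1), hall v⟩
      have h1 := Set.ncard_add_ncard_compl ({0} : Set V)
      rw [Set.ncard_singleton] at h1
      rw [hSe, add_comm (Set.ncard _) 1, h1, Module.natCard_eq_pow_finrank (K := F), h.1,
        Nat.card_eq_fintype_card]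
      exact Nat.pow_le_pow_right Fintype.card_pos h.2.1
    · push Not at hall
      obtain ⟨p, hp0, hpS⟩ := hall
      have : Finite (V ⧸ Submodule.span F {p}) := Finite.of_surjective _
        (Submodule.mkQ_surjective (Submodule.span F {p}))
      have h1 := ih _ _ (bb_proj n k S h p hp0 hpS)
      have h2 : ((Submodule.span F {p}).mkQ '' S).ncard ≤ S.ncard :=
        Set.ncard_image_le S.toFinite
      omega

/-- Equality case: the cone together with `0` is closed under addition. -/
theorem bb_eq {F : Type} [Field F] [Fintype F] (k n : ℕ) (V : Type) [AddCommGroup V]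
    [Module F V] [Finite V] (S : Set V) (h : ConeBlocking F n k S)
    (hc : S.ncard + 1 = Fintype.card F ^ (k + 1)) :
    ∃ W : Submodule F V, Module.finrank F W = k + 1 ∧ ∀ v, v ∈ S ↔ v ∈ W ∧ v ≠ 0 := by
  have hadd : ∀ x ∈ S, ∀ y ∈ S, x + y ≠ 0 → x + y ∈ S := by
    intro x hx y hy hxy
    by_contra hxyS
    obtain ⟨n, rfl⟩ : ∃ m, n = m + 1 := ⟨n - 1, by have := h.2.1; omega⟩
    have : Finite (V ⧸ Submodule.span F {x + y}) := Finite.of_surjective _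
        (Submodule.mkQ_surjective (Submodule.span F {x + y}))
    have h1 := bb_bound k _ _ _ (bb_proj n k S h _ hxy hxyS)
    have h2 : ((Submodule.span F {x + y}).mkQ '' S).ncard ≤ S.ncard :=
        Set.ncard_image_le S.toFinite
    have hinj : Set.InjOn (Submodule.span F {x + y}).mkQ S :=
      Set.injOn_of_ncard_image_eq (by omega) S.toFinite
    have hy' : -y ∈ S := by
      have := h.2.2.2.1 (-1) y (by simp) hy
      simpa using this
    have := hinj hx hy' (by
      rw [← sub_eq_zero, ← map_sub, sub_neg_eq_add]
      exact (Submodule.Quotient.mk_eq_zero _).2 (Submodule.mem_span_singleton_self _))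
    apply hxy; rw [this]; simp
  let W : Submodule F V :=
    { carrier := insert 0 S
      zero_mem' := Set.mem_insert _ _
      add_mem' := by
        rintro x y (rfl | hx) (rfl | hy)
        · simp
        · simpa using Or.inr hy
        · simpa using Or.inr hx
        · by_cases hxy : x + y = 0
          · exact Or.inl hxy
          · exact Or.inr (hadd x hx y hy hxy)
      smul_mem' := by
        rintro c x (rfl | hx)
        · simp
        · by_cases hc : c = 0
          · simp [hc]
          · exact Or.inr (h.2.2.2.1 c x hc hx) }
  refine ⟨W, ?_, ?_⟩
  · have h1 : Nat.card W = Fintype.card F ^ (k + 1) := by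
      rw [← hc, ← Set.ncard_insert_of_notMem h.2.2.1 S.toFinite]
      rfl
    rw [Module.natCard_eq_pow_finrank (K := F), Nat.card_eq_fintype_card] at h1
    exact Nat.pow_right_injective Fintype.one_lt_card h1
  · intro v
    have hW : v ∈ W ↔ v = 0 ∨ v ∈ S := Iff.rfl
    rw [hW]
    constructor
    · intro hv; exact ⟨Or.inr hv, fun h0 => h.2.2.1 (h0 ▸ hv)⟩
    · rintro ⟨hv | hv, h0⟩
      · exact absurd hv h0
      · exact hv

/-- Nonzero vectors spanning a point of `B`. -/
def coneOf {q n : ℕ} (B : Set (Submodule (ZMod q) (Fin n → ZMod q))) : Set (Fin n → ZMod q) :=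
  {v | v ≠ 0 ∧ projPoint v ∈ B}

theorem coneOf_blocking (q n k : ℕ) [Fact q.Prime] (hkn : k < n)
    (B : Set (Submodule (ZMod q) (Fin n → ZMod q))) (hB : IsBlockingSet q n k B) :
    ConeBlocking (ZMod q) n k (coneOf B) := by
  refine ⟨by simp, hkn, fun h => h.1 rfl, ?_, hB⟩
  rintro c v hc ⟨hv, hvB⟩
  refine ⟨smul_ne_zero hc hv, ?_⟩
  have : projPoint (c • v) = projPoint v :=
    Submodule.span_singleton_smul_eq (IsUnit.mk0 c hc) v
  rwa [this]

theorem coneOf_card (q n : ℕ) [Fact q.Prime]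
    (B : Set (Submodule (ZMod q) (Fin n → ZMod q))) :
    (coneOf B).ncard ≤ (q - 1) * B.ncard := by
  classical
  have : Finite (Submodule (ZMod q) (Fin n → ZMod q)) :=
    Finite.of_injective (fun W => (W : Set (Fin n → ZMod q))) SetLike.coe_injective
  have hBf := B.toFinite
  have hSf := (coneOf B).toFinite
  rw [Set.ncard_eq_toFinset_card _ hBf, Set.ncard_eq_toFinset_card _ hSf]
  refine Finset.card_le_mul_card_image_of_maps_to (f := projPoint) ?_ (q - 1) ?_
  · intro v hv
    rw [Set.Finite.mem_toFinset] at hv ⊢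
    exact hv.2
  · intro b hb
    rcases Finset.eq_empty_or_nonempty
      (hSf.toFinset.filter fun v => projPoint v = b) with he | ⟨w, hw⟩
    · rw [he]; simp
    · simp only [Finset.mem_filter, Set.Finite.mem_toFinset] at hw
      obtain ⟨hwS, rfl⟩ := hw
      have hsub : (hSf.toFinset.filter fun v => projPoint v = projPoint w) ⊆
          ((Finset.univ : Finset (ZMod q)).erase 0).image (fun c => c • w) := by
        intro v hv
        simp only [Finset.mem_filter, Set.Finite.mem_toFinset] at hv
        have hvw : v ∈ Submodule.span (ZMod q) {w} := by
          have : v ∈ projPoint v := Submodule.mem_span_singleton_self v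
          rw [hv.2] at this
          exact this
        obtain ⟨c, rfl⟩ := Submodule.mem_span_singleton.1 hvw
        refine Finset.mem_image.2 ⟨c, ?_, rfl⟩
        simp only [Finset.mem_erase, Finset.mem_univ, and_true]
        rintro rfl
        exact hv.1.1 (zero_smul _ _)
      refine (Finset.card_le_card hsub).trans (Finset.card_image_le.trans ?_)
      simp [ZMod.card]

theorem block_bound (q n k : ℕ) (hq : q.Prime) (hkn : k < n)
    (B : Set (Submodule (ZMod q) (Fin n → ZMod q))) (hB : IsBlockingSet q n k B) :
    (∑ i ∈ Finset.range (k + 1), q ^ i) ≤ B.ncard := by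
  have : Fact q.Prime := ⟨hq⟩
  have h1 := bb_bound k n _ _ (coneOf_blocking q n k hkn B hB)
  have h2 := coneOf_card q n B
  rw [ZMod.card] at h1
  have h3 := Nat.geomSum_eq hq.two_le (k + 1)
  have h4 := mul_geom_sum (q : ℤ) (k + 1)
  have hq2 := hq.two_le
  have h5 : (q - 1) * (∑ i ∈ Finset.range (k + 1), q ^ i) ≤ (q - 1) * B.ncard := by
    zify [hq.one_le] at h1 h2 ⊢
    linarith
  exact Nat.le_of_mul_le_mul_left h5 (by omega)


/-- **Proposition (Bose–Burton).** A `k`-blocking set of `PG(F_q^n)` has at least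
`(q^{k+1} - 1)/(q - 1) = q^k + ⋯ + q + 1` points, with equality iff it is a `k`-space. -/
theorem stmt7 (q n k : ℕ) (hq : q.Prime) (hk : 1 ≤ k) (hkn : k < n)
    (B : Set (Submodule (ZMod q) (Fin n → ZMod q))) (hB : IsBlockingSet q n k B) :
    (∑ i ∈ Finset.range (k + 1), q ^ i) ≤ B.ncard ∧
      (B.ncard = ∑ i ∈ Finset.range (k + 1), q ^ i → IsKSpace q n k B) := by
  have : Fact q.Prime := ⟨hq⟩
  refine ⟨block_bound q n k hq hkn B hB, fun hcard => ?_⟩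
  have hfin : Finite (Submodule (ZMod q) (Fin n → ZMod q)) :=
    Finite.of_injective (fun W => (W : Set (Fin n → ZMod q))) SetLike.coe_injective
  have hcone := coneOf_blocking q n k hkn B hB
  have hceq : (coneOf B).ncard + 1 = Fintype.card (ZMod q) ^ (k + 1) := by
    have h1 := bb_bound k n _ _ hcone
    have h2 := coneOf_card q n B
    rw [ZMod.card] at h1 ⊢
    have h4 := mul_geom_sum (q : ℤ) (k + 1)
    rw [hcard] at h2
    refine le_antisymm ?_ h1
    zify [hq.one_le] at h2 ⊢
    linarith
  obtain ⟨W, hW, hWS⟩ := bb_eq k n _ _ hcone hceq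
  refine ⟨W, hW, ?_⟩
  ext b
  constructor
  · intro hb
    by_contra hne
    have hB' : IsBlockingSet q n k (B \ {b}) := by
      intro U hU
      obtain ⟨v, hvU, hv0, hvB⟩ := hB U hU
      refine ⟨v, hvU, hv0, hvB, ?_⟩
      intro hvb
      exact hne ⟨v, ((hWS v).1 ⟨hv0, hvB⟩).1, hv0, hvb.symm⟩
    have h1 := block_bound q n k hq hkn _ hB'
    have h2 := Set.ncard_sdiff_singleton_lt_of_mem hb B.toFinite
    omega
  · rintro ⟨v, hvW, hv0, rfl⟩
    exact ((hWS v).2 ⟨hvW, hv0⟩).2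
end
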